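/- Let n ≥ 7 be odd and set k = ⌊n/2⌋. Then the polytope P^core_VSASM ⊆ ℝ^{n×k}, defined as the convex hull of the left n×k blocks { (x_{i,j})_{i∈{1,…,n}, j∈{1,…,k}} : X is an n×n VSASM }, has exactly 2n² − 19n + 49 facets. -/

import Mathlib

/-- An `n × n` alternating sign matrix: entries in `{-1, 0, 1}`, all row- and
column-prefix sums lie in `{0, 1}`, and all full row and column sums equal `1`. -/
def IsASM (n : ℕ) (X : Fin n → Fin n → ℝ) : Prop :=
  (∀ i j, X i j = -1 ∨ X i j = 0 ∨ X i j = 1) ∧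
  (∀ i j, (∑ j' ∈ Finset.Iic j, X i j') = 0 ∨ (∑ j' ∈ Finset.Iic j, X i j') = 1) ∧
  (∀ i j, (∑ i' ∈ Finset.Iic i, X i' j) = 0 ∨ (∑ i' ∈ Finset.Iic i, X i' j) = 1) ∧
  (∀ i, (∑ j, X i j) = 1) ∧
  (∀ j, (∑ i, X i j) = 1)

/-- A facet of a polytope `P`: a nonempty convex proper subset of `P` that is an
extreme subset of `P` and whose dimension is one less than that of `P`. -/
def IsFacetOf {E : Type*} [AddCommGroup E] [Module ℝ E] (P F : Set E) : Prop :=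
  F.Nonempty ∧ Convex ℝ F ∧ F ⊂ P ∧ IsExtreme ℝ P F ∧
    Module.finrank ℝ ↥(vectorSpan ℝ F) = Module.finrank ℝ ↥(vectorSpan ℝ P) - 1

section Polyhedron

variable {E κ : Type*} [AddCommGroup E] [Module ℝ E]

/-- The part of the affine subspace `o + W` cut out by the inequalities `0 ≤ ℓ c x + w c`, `c ∈ s`. -/
def polyhedron (W : Submodule ℝ E) (o : E) (s : Finset κ) (ℓ : κ → E →ₗ[ℝ] ℝ) (w : κ → ℝ) :
    Set E :=
  {x | x - o ∈ W ∧ ∀ c ∈ s, 0 ≤ ℓ c x + w c}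

variable {W : Submodule ℝ E} {o : E} {s : Finset κ} {ℓ : κ → E →ₗ[ℝ] ℝ} {w : κ → ℝ}

lemma convex_polyhedron : Convex ℝ (polyhedron W o s ℓ w) := by
  rintro x ⟨hx, hx'⟩ y ⟨hy, hy'⟩ a b ha hb hab
  refine ⟨?_, fun c hc => ?_⟩
  · have : a • x + b • y - o = a • (x - o) + b • (y - o) := by
      rw [smul_sub, smul_sub, sub_add_sub_comm, ← add_smul, hab, one_smul]
    rw [this]
    exact W.add_mem (W.smul_mem _ hx) (W.smul_mem _ hy)
  · have h1 := mul_nonneg ha (hx' c hc)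
    have h2 := mul_nonneg hb (hy' c hc)
    simp only [map_add, map_smul, smul_eq_mul]
    have : w c = a * w c + b * w c := by rw [← add_mul, hab, one_mul]
    linarith

lemma exists_pos_forall_nonneg_add_mul {f g : κ → ℝ}
    (h : ∀ c ∈ s, 0 < f c ∨ (0 ≤ f c ∧ 0 ≤ g c)) :
    ∃ ε : ℝ, 0 < ε ∧ ∀ c ∈ s, 0 ≤ f c + ε * g c := by
  have key : ∀ c ∈ s, ∀ᶠ ε : ℝ in nhdsWithin 0 (Set.Ioi 0), 0 ≤ f c + ε * g c := by
    intro c hc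
    rcases h c hc with h | ⟨h, h'⟩
    · have : Filter.Tendsto (fun ε : ℝ => f c + ε * g c) (nhds 0) (nhds (f c + 0 * g c)) :=
        Continuous.tendsto (by fun_prop) 0
      rw [zero_mul, add_zero] at this
      have h2 := (this.eventually (lt_mem_nhds h)).filter_mono
        (nhdsWithin_le_nhds (s := Set.Ioi 0))
      filter_upwards [h2] with ε hε using hε.le
    · filter_upwards [self_mem_nhdsWithin] with ε hε
      have : (0 : ℝ) < ε := hε
      positivity
  obtain ⟨ε, h1, h2⟩ :=
    (((Filter.eventually_all_finset s).2 key).and self_mem_nhdsWithin).exists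
  exact ⟨ε, h2, h1⟩

lemma exists_add_smul_mem_polyhedron {p d : E} (hp : p - o ∈ W)
    (hpos : ∀ c ∈ s, 0 < ℓ c p + w c) (hd : d ∈ W) :
    ∃ ε : ℝ, 0 < ε ∧ p + ε • d ∈ polyhedron W o s ℓ w := by
  obtain ⟨ε, hε, h⟩ := exists_pos_forall_nonneg_add_mul (s := s) (f := fun c => ℓ c p + w c)
    (g := fun c => ℓ c d) fun c hc => Or.inl (hpos c hc)
  refine ⟨ε, hε, ?_, fun c hc => ?_⟩
  · rw [add_sub_right_comm]
    exact W.add_mem hp (W.smul_mem _ hd)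
  · have := h c hc
    simp only [map_add, map_smul, smul_eq_mul]
    linarith

lemma vectorSpan_polyhedron {p : E} (hp : p - o ∈ W) (hpos : ∀ c ∈ s, 0 < ℓ c p + w c) :
    vectorSpan ℝ (polyhedron W o s ℓ w) = W := by
  apply le_antisymm
  · rw [vectorSpan_def, Submodule.span_le]
    rintro _ ⟨x, hx, y, hy, rfl⟩
    have := W.sub_mem hx.1 hy.1
    simpa using this
  · intro d hd
    obtain ⟨ε, hε, h⟩ := exists_add_smul_mem_polyhedron hp hpos hd
    have hpK : p ∈ polyhedron W o s ℓ w := ⟨hp, fun c hc => (hpos c hc).le⟩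
    have h1 := vsub_mem_vectorSpan ℝ h hpK
    have h2 := Submodule.smul_mem _ ε⁻¹ h1
    simpa [smul_smul, hε.ne'] using h2

lemma IsExtreme.eq_polyhedron_or {F : Set E} (hext : IsExtreme ℝ (polyhedron W o s ℓ w) F)
    (hconv : Convex ℝ F) (hne : F.Nonempty) :
    F = polyhedron W o s ℓ w ∨ ∃ c ∈ s, ∀ x ∈ F, ℓ c x + w c = 0 := by
  classical
  by_contra! hcon
  obtain ⟨hF, hs⟩ := hcon
  have key : ∀ t ⊆ s, ∃ p ∈ F, ∀ c ∈ t, 0 < ℓ c p + w c := by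
    intro t
    induction t using Finset.induction_on with
    | empty => exact fun _ => ⟨hne.some, hne.some_mem, by simp⟩
    | insert a t ha ih =>
      intro hts
      obtain ⟨p, hpF, hp⟩ := ih ((Finset.subset_insert a t).trans hts)
      have has : a ∈ s := hts (Finset.mem_insert_self a t)
      obtain ⟨q, hqF, hq⟩ := hs a has
      have hqa : 0 < ℓ a q + w a := lt_of_le_of_ne ((hext.subset hqF).2 a has) (Ne.symm hq)
      refine ⟨(1 / 2 : ℝ) • p + (1 / 2 : ℝ) • q,
        hconv hpF hqF (by norm_num) (by norm_num) (by norm_num), fun c hc => ?_⟩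
      simp only [map_add, map_smul, smul_eq_mul]
      have hp0 := (hext.subset hpF).2 c (hts hc)
      have hq0 := (hext.subset hqF).2 c (hts hc)
      rcases Finset.mem_insert.1 hc with rfl | hct
      · linarith
      · have := hp c hct
        linarith
  obtain ⟨p, hpF, hp⟩ := key s subset_rfl
  refine hF (hext.subset.antisymm fun q hq => ?_)
  have hpK := hext.subset hpF
  have hd : p - q ∈ W := by simpa using W.sub_mem hpK.1 hq.1
  obtain ⟨ε, hε, h⟩ := exists_add_smul_mem_polyhedron hpK.1 hp hd
  refine hext.left_mem_of_mem_openSegment hq h hpF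
    ⟨ε / (1 + ε), 1 / (1 + ε), by positivity, by positivity, by field_simp; ring, ?_⟩
  have h1 : ε / (1 + ε) = 1 - 1 / (1 + ε) := by
    field_simp
    ring
  have h2 : 1 / (1 + ε) * ε = 1 - 1 / (1 + ε) := by
    field_simp
    ring
  rw [smul_add, smul_smul, h1, h2]
  module

lemma finrank_inf_ker_add_one [Module.Finite ℝ E] (f : E →ₗ[ℝ] ℝ) {v : E} (hv : v ∈ W)
    (hf : f v ≠ 0) :
    Module.finrank ℝ ↥(W ⊓ LinearMap.ker f) + 1 = Module.finrank ℝ W := by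
  have hne : f.domRestrict W ≠ 0 := fun h => hf (by simpa using LinearMap.congr_fun h ⟨v, hv⟩)
  have h1 := Module.Dual.finrank_ker_add_one_of_ne_zero hne
  have h2 : (LinearMap.ker (f.domRestrict W)).map W.subtype = W ⊓ LinearMap.ker f := by
    ext x
    simp [and_comm]
  rw [← h1, ← h2, Submodule.finrank_map_subtype_eq]

/-- If a polyhedron has a point satisfying all its inequalities strictly and, for each inequality,
a point that violates only this one, then its facets correspond to its inequalities. -/
lemma ncard_facets_polyhedron [Module.Finite ℝ E] {p : E} (hp : p - o ∈ W)
    (hpos : ∀ c ∈ s, 0 < ℓ c p + w c)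
    (hviol : ∀ e ∈ s, ∃ y, y - o ∈ W ∧ ℓ e y + w e < 0 ∧ ∀ c ∈ s, c ≠ e → 0 ≤ ℓ c y + w c) :
    {F | IsFacetOf (polyhedron W o s ℓ w) F}.ncard = s.card := by
  classical
  set K := polyhedron W o s ℓ w with hK
  have htight : ∀ e ∈ s, ∃ z, z - o ∈ W ∧ ℓ e z + w e = 0 ∧
      ∀ c ∈ s, c ≠ e → 0 < ℓ c z + w c := by
    intro e he
    obtain ⟨y, hy, hye, hyc⟩ := hviol e he
    have hpe := hpos e he
    set a := ℓ e p + w e with ha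
    set b := -(ℓ e y + w e) with hb
    have hb0 : 0 < b := by linarith
    have hab : 0 < a + b := by linarith
    have hval : ∀ c, ℓ c ((b / (a + b)) • p + (a / (a + b)) • y) + w c =
        (b * (ℓ c p + w c) + a * (ℓ c y + w c)) / (a + b) := by
      intro c
      simp only [map_add, map_smul, smul_eq_mul]
      field_simp
      ring
    refine ⟨(b / (a + b)) • p + (a / (a + b)) • y, ?_, ?_, fun c hc hce => ?_⟩
    · have : (b / (a + b)) • p + (a / (a + b)) • y - o =
          (b / (a + b)) • (p - o) + (a / (a + b)) • (y - o) := by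
        rw [smul_sub, smul_sub, sub_add_sub_comm, ← add_smul, ← add_div, add_comm b a,
          div_self hab.ne', one_smul]
      rw [this]
      exact W.add_mem (W.smul_mem _ hp) (W.smul_mem _ hy)
    · rw [hval, ← ha, show ℓ e y + w e = -b by rw [hb, neg_neg]]
      ring
    · rw [hval]
      have h1 := mul_pos hb0 (hpos c hc)
      have h2 := mul_nonneg hpe.le (hyc c hc hce)
      positivity
  choose! z hzW hze hzc using htight
  have hzK : ∀ e ∈ s, z e ∈ K := fun e he => ⟨hzW e he, fun c hc => by
    by_cases h : c = e
    · rw [h, hze e he]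
    · exact (hzc e he c hc h).le⟩
  have hface : ∀ e ∈ s, {x ∈ K | ℓ e x + w e = 0} =
      polyhedron (W ⊓ LinearMap.ker (ℓ e)) (z e) (s.erase e) ℓ w := by
    intro e he
    ext x
    have hze' := hze e he
    have hw : x - z e ∈ W ↔ x - o ∈ W := by
      rw [← sub_sub_sub_cancel_right x (z e) o, W.sub_mem_iff_left (hzW e he)]
    have hk : ℓ e (x - z e) = 0 ↔ ℓ e x + w e = 0 := by
      rw [map_sub]
      constructor <;> intro h <;> linarith
    simp only [hK, polyhedron, Set.mem_ofPred_eq, Submodule.mem_inf, LinearMap.mem_ker, hw, hk,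
      Finset.mem_erase]
    constructor
    · rintro ⟨⟨h1, h2⟩, h3⟩
      exact ⟨⟨h1, h3⟩, fun c hc => h2 c hc.2⟩
    · rintro ⟨⟨h1, h3⟩, h2⟩
      refine ⟨⟨h1, fun c hc => ?_⟩, h3⟩
      by_cases h : c = e
      · rw [h, h3]
      · exact h2 c ⟨h, hc⟩
  have hspanK : vectorSpan ℝ K = W := vectorSpan_polyhedron hp hpos
  have hspan : ∀ e ∈ s, vectorSpan ℝ {x ∈ K | ℓ e x + w e = 0} = W ⊓ LinearMap.ker (ℓ e) := by
    intro e he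
    rw [hface e he]
    refine vectorSpan_polyhedron (p := z e) (by simp) fun c hc => ?_
    rw [Finset.mem_erase] at hc
    exact hzc e he c hc.2 hc.1
  have hdim : ∀ e ∈ s, Module.finrank ℝ ↥(W ⊓ LinearMap.ker (ℓ e)) = Module.finrank ℝ W - 1 := by
    intro e he
    have hv : p - z e ∈ W := by simpa using W.sub_mem hp (hzW e he)
    have := finrank_inf_ker_add_one (ℓ e) hv (by
      rw [map_sub]
      have h1 := hpos e he
      have h2 := hze e he
      intro h
      linarith)
    omega
  have hset : {F | IsFacetOf K F} = (fun e => {x ∈ K | ℓ e x + w e = 0}) '' (s : Set κ) := by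
    ext F
    constructor
    · rintro ⟨hne, hconv, hsub, hext, hfin⟩
      rcases hext.eq_polyhedron_or hconv hne with h | ⟨e, he, hFe⟩
      · exact absurd h hsub.ne
      refine ⟨e, he, ?_⟩
      have hle : F ⊆ {x ∈ K | ℓ e x + w e = 0} := fun x hx => ⟨hsub.1 hx, hFe x hx⟩
      have hspanF : vectorSpan ℝ F = W ⊓ LinearMap.ker (ℓ e) := by
        refine Submodule.eq_of_le_of_finrank_eq ?_ ?_
        · rw [← hspan e he]
          exact vectorSpan_mono ℝ hle
        · rw [hfin, hdim e he, hspanK]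
      have hext' : IsExtreme ℝ {x ∈ K | ℓ e x + w e = 0} F := hext.mono (Set.sep_subset _ _) hle
      rw [hface e he] at hext'
      rcases hext'.eq_polyhedron_or hconv hne with h | ⟨c, hc, hFc⟩
      · simp only [hface e he, h]
      exfalso
      rw [Finset.mem_erase] at hc
      obtain ⟨x, hx⟩ := hne
      have hxW : z e - x ∈ vectorSpan ℝ F := by
        rw [hspanF, ← hspan e he]
        exact vsub_mem_vectorSpan ℝ ⟨hzK e he, hze e he⟩ (hle hx)
      have hker : vectorSpan ℝ F ≤ LinearMap.ker (ℓ c) := by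
        rw [vectorSpan_def, Submodule.span_le]
        rintro _ ⟨x, hx, y, hy, rfl⟩
        have h1 := hFc x hx
        have h2 := hFc y hy
        simp only [vsub_eq_sub, SetLike.mem_coe, LinearMap.mem_ker, map_sub]
        linarith
      have h1 := hker hxW
      rw [LinearMap.mem_ker, map_sub] at h1
      have h2 := hzc e he c hc.2 hc.1
      have h3 := hFc x hx
      linarith
    · rintro ⟨e, he, rfl⟩
      refine ⟨⟨z e, hzK e he, hze e he⟩, ?_, ⟨Set.sep_subset _ _, fun h => ?_⟩, ?_, ?_⟩
      · simp only [hface e he]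
        exact convex_polyhedron
      · exact (hpos e he).ne' (h ⟨hp, fun c hc => (hpos c hc).le⟩).2
      · refine ⟨Set.sep_subset _ _, ?_⟩
        rintro x hx y hy u ⟨-, hu⟩ ⟨a, b, ha, hb, hab, rfl⟩
        refine ⟨hx, ?_⟩
        have h1 := hx.2 e he
        have h2 := hy.2 e he
        simp only [map_add, map_smul, smul_eq_mul] at hu
        have h3 : a * (ℓ e x + w e) + b * (ℓ e y + w e) = 0 := by
          linear_combination hu + w e * hab
        have h4 := mul_nonneg ha.le h1
        have h5 := mul_nonneg hb.le h2
        have h6 : a * (ℓ e x + w e) = 0 := by linarith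
        exact (mul_eq_zero.1 h6).resolve_left ha.ne'
      · have h := hdim e he
        rwa [← hspan e he, ← hspanK] at h
  rw [hset, Set.InjOn.ncard_image, Set.ncard_coe_finset]
  intro e he e' he' h
  by_contra hne
  have h1 : z e ∈ {x ∈ K | ℓ e' x + w e' = 0} := by
    have : z e ∈ {x ∈ K | ℓ e x + w e = 0} := ⟨hzK e he, hze e he⟩
    rwa [show {x ∈ K | ℓ e x + w e = 0} = _ from h] at this
  exact (hzc e he e' he' (Ne.symm hne)).ne' h1.2

end Polyhedron

section Witnesses

/-- The kinds of facet-defining inequalities: bounds on the horizontal or vertical steps of the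
corner sums, by the parity of the row. -/
inductive StepBound
  | horizEvenLower | horizOddLower | horizEvenUpper | horizOddUpper
  | vertOddLower | vertEvenLower | vertEvenUpper | vertOddUpper
  deriving DecidableEq

namespace StepBound

instance : Fintype StepBound where
  elems := {horizEvenLower, horizOddLower, horizEvenUpper, horizOddUpper, vertOddLower,
    vertEvenLower, vertEvenUpper, vertOddUpper}
  complete c := by cases c <;> decide

/-- The position counted positively in a step bound. -/
def plus : StepBound → ℕ → ℕ → ℕ × ℕ
  | horizEvenLower, m, j => (2 * m, j)
  | horizOddLower, m, j => (2 * m + 1, j)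
  | horizEvenUpper, m, j => (2 * m, j - 1)
  | horizOddUpper, m, j => (2 * m + 1, j - 1)
  | vertOddLower, m, j => (2 * m + 1, j)
  | vertEvenLower, m, j => (2 * m, j)
  | vertEvenUpper, m, j => (2 * m - 1, j)
  | vertOddUpper, m, j => (2 * m, j)

/-- The position counted negatively in a step bound. -/
def minus : StepBound → ℕ → ℕ → ℕ × ℕ
  | horizEvenLower, m, j => (2 * m, j - 1)
  | horizOddLower, m, j => (2 * m + 1, j - 1)
  | horizEvenUpper, m, j => (2 * m, j)
  | horizOddUpper, m, j => (2 * m + 1, j)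
  | vertOddLower, m, j => (2 * m, j)
  | vertEvenLower, m, j => (2 * m - 1, j)
  | vertEvenUpper, m, j => (2 * m, j)
  | vertOddUpper, m, j => (2 * m + 1, j)

/-- The constant term of a step bound. -/
def offset : StepBound → ℤ
  | horizEvenUpper | horizOddUpper | vertEvenUpper | vertOddUpper => 1
  | _ => 0

/-- The places where a step bound defines a facet. -/
def region (k : ℕ) : StepBound → Finset (ℕ × ℕ)
  | horizEvenLower => insert (1, 1) (Finset.Icc 1 (k - 2) ×ˢ Finset.Icc 2 (k - 1))
  | horizOddLower => Finset.Icc 1 (k - 2) ×ˢ Finset.Icc 2 k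
  | horizEvenUpper => Finset.Icc 2 (k - 1) ×ˢ Finset.Icc 2 k
  | horizOddUpper => insert (k - 1, 1) (Finset.Icc 2 (k - 1) ×ˢ Finset.Icc 2 (k - 1))
  | vertOddLower => Finset.Icc 1 (k - 1) ×ˢ Finset.Icc 1 (k - 1)
  | vertEvenLower => Finset.Icc 2 (k - 1) ×ˢ Finset.Icc 1 (k - 2)
  | vertEvenUpper => Finset.Icc 2 (k - 1) ×ˢ Finset.Icc 2 (k - 1)
  | vertOddUpper => Finset.Icc 2 (k - 2) ×ˢ Finset.Icc 2 (k - 2)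

end StepBound

/-- The places of all facet-defining inequalities. -/
def facetIndex (k : ℕ) : Finset (Σ _ : StepBound, ℕ × ℕ) :=
  Finset.univ.sigma (StepBound.region k)

lemma card_facetIndex {k : ℕ} (hk : 3 ≤ k) :
    (facetIndex k).card = 2 * (2 * k + 1) ^ 2 + 49 - 19 * (2 * k + 1) := by
  obtain ⟨a, rfl⟩ := Nat.exists_eq_add_of_le hk
  have huniv : (Finset.univ : Finset StepBound) = {.horizEvenLower, .horizOddLower,
    .horizEvenUpper, .horizOddUpper, .vertOddLower, .vertEvenLower, .vertEvenUpper,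
    .vertOddUpper} := rfl
  rw [facetIndex, Finset.card_sigma, huniv]
  simp only [Finset.sum_insert, Finset.mem_insert, Finset.mem_singleton, reduceCtorEq, or_self,
    not_false_eq_true, Finset.sum_singleton, StepBound.region]
  rw [Finset.card_insert_of_notMem (by simp), Finset.card_insert_of_notMem (by simp)]
  simp only [Finset.card_product, Nat.card_Icc]
  rw [show 3 + a - 2 = a + 1 by omega, show 3 + a - 1 = a + 2 by omega,
    show a + 1 + 1 - 2 = a by omega, show a + 1 + 1 - 1 = a + 1 by omega,
    show a + 2 + 1 - 2 = a + 1 by omega, show a + 2 + 1 - 1 = a + 2 by omega,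
    show 3 + a + 1 - 2 = a + 2 by omega]
  symm
  rw [Nat.sub_eq_iff_eq_add (by nlinarith)]
  ring

/-- The linear part of a step bound at an array. -/
def stepDiff {R : Type*} [Sub R] (c : Σ _ : StepBound, ℕ × ℕ) (z : ℕ → ℕ → R) : R :=
  z (c.1.plus c.2.1 c.2.2).1 (c.1.plus c.2.1 c.2.2).2 -
    z (c.1.minus c.2.1 c.2.2).1 (c.1.minus c.2.1 c.2.2).2

/-- The corner sums of the permutation matrix of a cyclic shift by `s`. -/
def cyclicSum (k s m j : ℕ) : ℤ := (min m (j - s) + min j (m - (k - s)) : ℕ)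

/-- The indicator of a rectangle. -/
def boxInd (i₀ i₁ j₀ j₁ i j : ℕ) : ℤ := if i₀ ≤ i ∧ i ≤ i₁ ∧ j₀ ≤ j ∧ j ≤ j₁ then 1 else 0

/-- `z` has the values which the corner sums of a symmetric alternating sign matrix have to have on
the boundary. -/
def BoundaryValues {R : Type*} [AddGroupWithOne R] (k : ℕ) (z : ℕ → ℕ → R) : Prop :=
  (∀ i, z i 0 = 0) ∧ (∀ i ≤ 2 * k + 1, z i k = (i / 2 : ℕ)) ∧
    ∀ j ≤ k, z 0 j = 0 ∧ z 1 j = 0 ∧ z (2 * k) j = j ∧ z (2 * k + 1) j = j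

/-- `z` vanishes on the boundary. -/
def BoundaryZero {R : Type*} [AddGroupWithOne R] (k : ℕ) (z : ℕ → ℕ → R) : Prop :=
  (∀ i, z i 0 = 0) ∧ (∀ i ≤ 2 * k + 1, z i k = 0) ∧
    ∀ j ≤ k, z 0 j = 0 ∧ z 1 j = 0 ∧ z (2 * k) j = 0 ∧ z (2 * k + 1) j = 0

lemma boundaryZero_boxInd {k i₀ i₁ j₀ j₁ : ℕ} (hi₀ : 2 ≤ i₀) (hi₁ : i₁ < 2 * k) (hj₀ : 1 ≤ j₀)
    (hj₁ : j₁ < k) (a : ℤ) : BoundaryZero k fun i j => a * boxInd i₀ i₁ j₀ j₁ i j := by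
  refine ⟨fun i => ?_, fun i hi => ?_, fun j hj => ⟨?_, ?_, ?_, ?_⟩⟩ <;>
  · simp only [boxInd, mul_ite, mul_one, mul_zero]
    rw [if_neg (by omega)]

lemma boundaryValues_cyclicSum {k s : ℕ} (hs : s < k) :
    BoundaryValues k fun i j => cyclicSum k s (i / 2) j := by
  refine ⟨fun i => ?_, fun i hi => ?_, fun j hj => ⟨?_, ?_, ?_, ?_⟩⟩ <;> simp only [cyclicSum] <;>
  omega

lemma boundaryValues_sub_cyclicSum {k s : ℕ} (hs : s < k) :
    BoundaryValues k fun i j => j - cyclicSum k s (k - i / 2) j := by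
  refine ⟨fun i => ?_, fun i hi => ?_, fun j hj => ⟨?_, ?_, ?_, ?_⟩⟩ <;> simp only [cyclicSum] <;>
  omega

lemma BoundaryValues.sub {k : ℕ} {z d : ℕ → ℕ → ℤ} (hz : BoundaryValues k z)
    (hd : BoundaryZero k d) : BoundaryValues k fun i j => z i j - d i j := by
  refine ⟨fun i => ?_, fun i hi => ?_, fun j hj => ?_⟩
  · simp [hz.1, hd.1]
  · simp [hz.2.1 i hi, hd.2.1 i hi]
  · obtain ⟨h1, h2, h3, h4⟩ := hz.2.2 j hj
    obtain ⟨h1', h2', h3', h4'⟩ := hd.2.2 j hj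
    simp [h1, h2, h3, h4, h1', h2', h3', h4']

/-- The array `z` attains the step bound `e`, the direction `d` violates it, and no other facet
inequality is violated by moving from `z` in direction `d` by a small amount. -/
structure IsWitness (k : ℕ) (e : Σ _ : StepBound, ℕ × ℕ) (z d : ℕ → ℕ → ℤ) : Prop where
  boundary : BoundaryValues k z
  boundaryZero : BoundaryZero k d
  tight : stepDiff e z + e.1.offset = 0
  violated : stepDiff e d < 0
  others : ∀ c ∈ facetIndex k, c ≠ e →
    0 < stepDiff c z + c.1.offset ∨ (0 ≤ stepDiff c z + c.1.offset ∧ 0 ≤ stepDiff c d)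

/-- The slacks of the step bounds at the corner sums of a cyclic shift. -/
def cyclicSlack (k s : ℕ) : StepBound → ℕ → ℕ → ℤ
  | .horizEvenLower, m, j | .horizOddLower, m, j =>
    if (s < j ∧ j ≤ s + m) ∨ j + k ≤ s + m then 1 else 0
  | .horizEvenUpper, m, j | .horizOddUpper, m, j =>
    if (s < j ∧ j ≤ s + m) ∨ j + k ≤ s + m then 0 else 1
  | .vertOddLower, _, _ => 0
  | .vertOddUpper, _, _ => 1
  | .vertEvenLower, m, j => if (m + s ≤ k ∧ m + s ≤ j) ∨ (k < m + s ∧ m + s ≤ j + k) then 1 else 0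
  | .vertEvenUpper, m, j => if (m + s ≤ k ∧ m + s ≤ j) ∨ (k < m + s ∧ m + s ≤ j + k) then 0 else 1

/-- The slacks of the step bounds at the corner sums of a cyclic shift turned upside down. -/
def revCyclicSlack (k s : ℕ) : StepBound → ℕ → ℕ → ℤ
  | .horizEvenLower, m, j | .horizOddLower, m, j =>
    if (s < j ∧ j + m ≤ s + k) ∨ j + m ≤ s then 0 else 1
  | .horizEvenUpper, m, j | .horizOddUpper, m, j =>
    if (s < j ∧ j + m ≤ s + k) ∨ j + m ≤ s then 1 else 0
  | .vertOddLower, _, _ => 0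
  | .vertOddUpper, _, _ => 1
  | .vertEvenLower, m, j => if (s < m ∧ k + 1 + s ≤ j + m) ∨ (m ≤ s ∧ s < j + m) then 1 else 0
  | .vertEvenUpper, m, j => if (s < m ∧ k + 1 + s ≤ j + m) ∨ (m ≤ s ∧ s < j + m) then 0 else 1

lemma cyclicSum_right {k s m j : ℕ} (hs : s < k) (hm : m ≤ k) (hj : 1 ≤ j) (hjk : j ≤ k) :
    cyclicSum k s m j = cyclicSum k s m (j - 1) +
      if (s < j ∧ j ≤ s + m) ∨ j + k ≤ s + m then 1 else 0 := by
  simp only [cyclicSum]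
  omega

lemma cyclicSum_down {k s m j : ℕ} (hs : s < k) (hm : 1 ≤ m) (hmk : m ≤ k) (hjk : j ≤ k) :
    cyclicSum k s m j = cyclicSum k s (m - 1) j +
      if (m + s ≤ k ∧ m + s ≤ j) ∨ (k < m + s ∧ m + s ≤ j + k) then 1 else 0 := by
  simp only [cyclicSum]
  omega

lemma mem_region_bounds {k m j : ℕ} {c : StepBound} (hk : 3 ≤ k) (h : (m, j) ∈ c.region k) :
    1 ≤ m ∧ m + 1 ≤ k ∧ 1 ≤ j ∧ j ≤ k := by
  rcases c <;>
  simp only [StepBound.region, Finset.mem_insert, Prod.mk.injEq, Finset.mem_product,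
    Finset.mem_Icc] at h <;>
  omega

lemma stepDiff_cyclicSum {k s m j : ℕ} (hs : s < k) {c : StepBound} (hk : 3 ≤ k)
    (h : (m, j) ∈ c.region k) :
    stepDiff ⟨c, m, j⟩ (fun i' j' => cyclicSum k s (i' / 2) j') + c.offset =
      cyclicSlack k s c m j := by
  obtain ⟨h1, h2, h3, h4⟩ := mem_region_bounds hk h
  have hr := cyclicSum_right hs (by omega) h3 h4 (m := m)
  have hd := cyclicSum_down hs h1 (by omega) h4
  have e1 : 2 * m / 2 = m := by omega
  have e2 : (2 * m + 1) / 2 = m := by omega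
  have e3 : (2 * m - 1) / 2 = m - 1 := by omega
  rcases c <;>
  simp only [stepDiff, StepBound.plus, StepBound.minus, StepBound.offset, cyclicSlack, e1, e2, e3]
    at hr hd ⊢ <;>
  split_ifs at hr hd ⊢ <;> linarith

lemma stepDiff_sub_cyclicSum {k s m j : ℕ} (hs : s < k) {c : StepBound} (hk : 3 ≤ k)
    (h : (m, j) ∈ c.region k) :
    stepDiff ⟨c, m, j⟩ (fun i' j' => j' - cyclicSum k s (k - i' / 2) j') + c.offset =
      revCyclicSlack k s c m j := by
  obtain ⟨h1, h2, h3, h4⟩ := mem_region_bounds hk h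
  have hr := cyclicSum_right hs (by omega) h3 h4 (m := k - m)
  have hd := cyclicSum_down hs (by omega) (by omega) h4 (m := k - m + 1)
  have e1 : 2 * m / 2 = m := by omega
  have e2 : (2 * m + 1) / 2 = m := by omega
  have e3 : k - (2 * m - 1) / 2 = k - m + 1 := by omega
  have e4 : ((j - 1 : ℕ) : ℤ) = j - 1 := by omega
  rw [Nat.add_sub_cancel] at hd
  rcases c <;>
  simp only [stepDiff, StepBound.plus, StepBound.minus, StepBound.offset, revCyclicSlack, e1, e2,
    e3, e4] at hr hd ⊢ <;>
  split_ifs at hr hd ⊢ <;> omega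

lemma IsWitness.of_forall {k m j : ℕ} {t : StepBound} {z d : ℕ → ℕ → ℤ} (hz : BoundaryValues k z)
    (hd : BoundaryZero k d) (ht : stepDiff ⟨t, m, j⟩ z + t.offset = 0)
    (hv : stepDiff ⟨t, m, j⟩ d < 0)
    (ho : ∀ c a b, (a, b) ∈ StepBound.region k c → (c = t → ¬(a = m ∧ b = j)) →
      0 ≤ stepDiff ⟨c, a, b⟩ z + c.offset ∧
        (stepDiff ⟨c, a, b⟩ d < 0 → 0 < stepDiff ⟨c, a, b⟩ z + c.offset)) :
    IsWitness k ⟨t, m, j⟩ z d := by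
  refine ⟨hz, hd, ht, hv, ?_⟩
  rintro ⟨c, a, b⟩ hc hne
  obtain ⟨h1, h2⟩ := ho c a b (by simpa [facetIndex] using hc) (by
    rintro rfl ⟨rfl, rfl⟩
    exact hne rfl)
  rcases lt_or_ge (stepDiff ⟨c, a, b⟩ d) 0 with h | h
  · exact Or.inl (h2 h)
  · exact Or.inr ⟨h1, h⟩

lemma cyclicSlack_nonneg (k s : ℕ) (c : StepBound) (m j : ℕ) : 0 ≤ cyclicSlack k s c m j := by
  rcases c <;> simp only [cyclicSlack] <;> positivity

lemma revCyclicSlack_nonneg (k s : ℕ) (c : StepBound) (m j : ℕ) :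
    0 ≤ revCyclicSlack k s c m j := by
  rcases c <;> simp only [revCyclicSlack] <;> positivity

lemma stepDiff_boxInd_neg {i₀ i₁ j₀ j₁ a b : ℕ} {c : StepBound}
    (h : stepDiff ⟨c, a, b⟩ (fun i j => 1 * boxInd i₀ i₁ j₀ j₁ i j) < 0) :
    (i₀ ≤ (c.minus a b).1 ∧ (c.minus a b).1 ≤ i₁ ∧ j₀ ≤ (c.minus a b).2 ∧ (c.minus a b).2 ≤ j₁) ∧
    ¬(i₀ ≤ (c.plus a b).1 ∧ (c.plus a b).1 ≤ i₁ ∧ j₀ ≤ (c.plus a b).2 ∧ (c.plus a b).2 ≤ j₁) := by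
  simp only [stepDiff, boxInd] at h
  split_ifs at h with h1 h2 h2
  · simp at h
  · simp at h
  · exact ⟨h2, h1⟩
  · simp at h

lemma stepDiff_neg_boxInd_neg {i₀ i₁ j₀ j₁ a b : ℕ} {c : StepBound}
    (h : stepDiff ⟨c, a, b⟩ (fun i j => -1 * boxInd i₀ i₁ j₀ j₁ i j) < 0) :
    (i₀ ≤ (c.plus a b).1 ∧ (c.plus a b).1 ≤ i₁ ∧ j₀ ≤ (c.plus a b).2 ∧ (c.plus a b).2 ≤ j₁) ∧
    ¬(i₀ ≤ (c.minus a b).1 ∧ (c.minus a b).1 ≤ i₁ ∧ j₀ ≤ (c.minus a b).2 ∧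
      (c.minus a b).2 ≤ j₁) := by
  simp only [stepDiff, boxInd] at h
  split_ifs at h with h1 h2 h2
  · simp at h
  · exact ⟨h1, h2⟩
  · simp at h
  · simp at h

lemma isWitness_horizEvenLower {k m j s : ℕ} (hk : 3 ≤ k)
    (h : (m, j) ∈ StepBound.region k .horizEvenLower) (hsk : s < k)
    (hs : s + m + 1 = j ∨ s + m + 1 = j + k) :
    IsWitness k ⟨.horizEvenLower, m, j⟩
      (fun i' j' => cyclicSum k s (i' / 2) j')
      (fun i' j' => -1 * boxInd (2 * m) (2 * m) j j i' j') := by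
  have hb := h
  simp only [StepBound.region, Finset.mem_insert, Prod.mk.injEq, Finset.mem_product,
    Finset.mem_Icc] at hb
  refine .of_forall (boundaryValues_cyclicSum hsk)
    (boundaryZero_boxInd (by omega) (by omega) (by omega)
    (by omega) _) ?_ ?_ fun c a b hc hne => ?_
  · rw [stepDiff_cyclicSum hsk hk h]
    simp only [cyclicSlack]
    omega
  · simp only [stepDiff, StepBound.plus, StepBound.minus, boxInd]
    omega
  · rw [stepDiff_cyclicSum hsk hk hc]
    refine ⟨cyclicSlack_nonneg _ _ _ _ _, fun hneg => ?_⟩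
    have hneg' := stepDiff_neg_boxInd_neg hneg
    clear hneg h
    rcases c <;>
    simp only [StepBound.region, Finset.mem_insert, Prod.mk.injEq, Finset.mem_product,
      Finset.mem_Icc, reduceCtorEq, false_implies, true_implies] at hc hne <;>
    simp only [StepBound.plus, StepBound.minus] at hneg' <;>
    simp only [cyclicSlack] <;>
    omega

lemma isWitness_horizOddLower {k m j s : ℕ} (hk : 3 ≤ k)
    (h : (m, j) ∈ StepBound.region k .horizOddLower) (hsk : s < k)
    (hs : s + m + 2 = j ∨ s + m + 2 = j + k) :
    IsWitness k ⟨.horizOddLower, m, j⟩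
      (fun i' j' => cyclicSum k s (i' / 2) j')
      (fun i' j' => 1 * boxInd (2 * m + 1) (2 * m + 1) (j - 1) (j - 1) i' j') := by
  have hb := h
  simp only [StepBound.region, Finset.mem_product,
    Finset.mem_Icc] at hb
  refine .of_forall (boundaryValues_cyclicSum hsk)
    (boundaryZero_boxInd (by omega) (by omega) (by omega)
    (by omega) _) ?_ ?_ fun c a b hc hne => ?_
  · rw [stepDiff_cyclicSum hsk hk h]
    simp only [cyclicSlack]
    omega
  · simp only [stepDiff, StepBound.plus, StepBound.minus, boxInd]
    omega
  · rw [stepDiff_cyclicSum hsk hk hc]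
    refine ⟨cyclicSlack_nonneg _ _ _ _ _, fun hneg => ?_⟩
    have hneg' := stepDiff_boxInd_neg hneg
    clear hneg h
    rcases c <;>
    simp only [StepBound.region, Finset.mem_insert, Prod.mk.injEq, Finset.mem_product,
      Finset.mem_Icc, reduceCtorEq, false_implies, true_implies] at hc hne <;>
    simp only [StepBound.plus, StepBound.minus] at hneg' <;>
    simp only [cyclicSlack] <;>
    omega

lemma isWitness_horizEvenUpper {k m j s : ℕ} (hk : 3 ≤ k)
    (h : (m, j) ∈ StepBound.region k .horizEvenUpper) (hsk : s < k)
    (hs : s + k + 2 = j + m ∨ s + 2 = j + m) :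
    IsWitness k ⟨.horizEvenUpper, m, j⟩
      (fun i' j' => j' - cyclicSum k s (k - i' / 2) j')
      (fun i' j' => -1 * boxInd (2 * m) (2 * m) (j - 1) (j - 1) i' j') := by
  have hb := h
  simp only [StepBound.region, Finset.mem_product,
    Finset.mem_Icc] at hb
  refine .of_forall (boundaryValues_sub_cyclicSum hsk)
    (boundaryZero_boxInd (by omega) (by omega) (by omega)
    (by omega) _) ?_ ?_ fun c a b hc hne => ?_
  · rw [stepDiff_sub_cyclicSum hsk hk h]
    simp only [revCyclicSlack]
    omega
  · simp only [stepDiff, StepBound.plus, StepBound.minus, boxInd]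
    omega
  · rw [stepDiff_sub_cyclicSum hsk hk hc]
    refine ⟨revCyclicSlack_nonneg _ _ _ _ _, fun hneg => ?_⟩
    have hneg' := stepDiff_neg_boxInd_neg hneg
    clear hneg h
    rcases c <;>
    simp only [StepBound.region, Finset.mem_insert, Prod.mk.injEq, Finset.mem_product,
      Finset.mem_Icc, reduceCtorEq, false_implies, true_implies] at hc hne <;>
    simp only [StepBound.plus, StepBound.minus] at hneg' <;>
    simp only [revCyclicSlack] <;>
    omega

lemma isWitness_horizOddUpper {k m j s : ℕ} (hk : 3 ≤ k)
    (h : (m, j) ∈ StepBound.region k .horizOddUpper) (hsk : s < k)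
    (hs : s + k + 1 = j + m ∨ s + 1 = j + m) :
    IsWitness k ⟨.horizOddUpper, m, j⟩
      (fun i' j' => j' - cyclicSum k s (k - i' / 2) j')
      (fun i' j' => 1 * boxInd (2 * m + 1) (2 * m + 1) j j i' j') := by
  have hb := h
  simp only [StepBound.region, Finset.mem_insert, Prod.mk.injEq, Finset.mem_product,
    Finset.mem_Icc] at hb
  refine .of_forall (boundaryValues_sub_cyclicSum hsk)
    (boundaryZero_boxInd (by omega) (by omega) (by omega)
    (by omega) _) ?_ ?_ fun c a b hc hne => ?_
  · rw [stepDiff_sub_cyclicSum hsk hk h]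
    simp only [revCyclicSlack]
    omega
  · simp only [stepDiff, StepBound.plus, StepBound.minus, boxInd]
    omega
  · rw [stepDiff_sub_cyclicSum hsk hk hc]
    refine ⟨revCyclicSlack_nonneg _ _ _ _ _, fun hneg => ?_⟩
    have hneg' := stepDiff_boxInd_neg hneg
    clear hneg h
    rcases c <;>
    simp only [StepBound.region, Finset.mem_insert, Prod.mk.injEq, Finset.mem_product,
      Finset.mem_Icc, reduceCtorEq, false_implies, true_implies] at hc hne <;>
    simp only [StepBound.plus, StepBound.minus] at hneg' <;>
    simp only [revCyclicSlack] <;>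
    omega

lemma isWitness_vertOddLower {k m j s : ℕ} (hk : 3 ≤ k)
    (h : (m, j) ∈ StepBound.region k .vertOddLower) (hsk : s < k)
    (hs : s + m = j ∨ s + m = j + k) :
    IsWitness k ⟨.vertOddLower, m, j⟩
      (fun i' j' => cyclicSum k s (i' / 2) j')
      (fun i' j' => -1 * boxInd (2 * m + 1) (2 * m + 1) j j i' j') := by
  have hb := h
  simp only [StepBound.region, Finset.mem_product,
    Finset.mem_Icc] at hb
  refine .of_forall (boundaryValues_cyclicSum hsk)
    (boundaryZero_boxInd (by omega) (by omega) (by omega)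
    (by omega) _) ?_ ?_ fun c a b hc hne => ?_
  · rw [stepDiff_cyclicSum hsk hk h]
    simp only [cyclicSlack]
  · simp only [stepDiff, StepBound.plus, StepBound.minus, boxInd]
    omega
  · rw [stepDiff_cyclicSum hsk hk hc]
    refine ⟨cyclicSlack_nonneg _ _ _ _ _, fun hneg => ?_⟩
    have hneg' := stepDiff_neg_boxInd_neg hneg
    clear hneg h
    rcases c <;>
    simp only [StepBound.region, Finset.mem_insert, Prod.mk.injEq, Finset.mem_product,
      Finset.mem_Icc, reduceCtorEq, false_implies, true_implies] at hc hne <;>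
    simp only [StepBound.plus, StepBound.minus] at hneg' <;>
    simp only [cyclicSlack] <;>
    omega

lemma isWitness_vertEvenLower {k m j s : ℕ} (hk : 3 ≤ k)
    (h : (m, j) ∈ StepBound.region k .vertEvenLower) (hsk : s < k)
    (hs : s + m = j + 1 ∨ s + m = j + 1 + k) :
    IsWitness k ⟨.vertEvenLower, m, j⟩
      (fun i' j' => cyclicSum k s (i' / 2) j')
      (fun i' j' => -1 * boxInd (2 * m) (2 * m) j (j + 1) i' j') := by
  have hb := h
  simp only [StepBound.region, Finset.mem_product,
    Finset.mem_Icc] at hb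
  refine .of_forall (boundaryValues_cyclicSum hsk)
    (boundaryZero_boxInd (by omega) (by omega) (by omega)
    (by omega) _) ?_ ?_ fun c a b hc hne => ?_
  · rw [stepDiff_cyclicSum hsk hk h]
    simp only [cyclicSlack]
    omega
  · simp only [stepDiff, StepBound.plus, StepBound.minus, boxInd]
    omega
  · rw [stepDiff_cyclicSum hsk hk hc]
    refine ⟨cyclicSlack_nonneg _ _ _ _ _, fun hneg => ?_⟩
    have hneg' := stepDiff_neg_boxInd_neg hneg
    clear hneg h
    rcases c <;>
    simp only [StepBound.region, Finset.mem_insert, Prod.mk.injEq, Finset.mem_product,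
      Finset.mem_Icc, reduceCtorEq, false_implies, true_implies] at hc hne <;>
    simp only [StepBound.plus, StepBound.minus] at hneg' <;>
    simp only [cyclicSlack] <;>
    omega

lemma isWitness_vertEvenUpper {k m j s : ℕ} (hk : 3 ≤ k)
    (h : (m, j) ∈ StepBound.region k .vertEvenUpper) (hsk : s < k)
    (hs : s + m = j ∨ s + m = j + k) :
    IsWitness k ⟨.vertEvenUpper, m, j⟩
      (fun i' j' => cyclicSum k s (i' / 2) j')
      (fun i' j' => -1 * boxInd (2 * m - 2) (2 * m - 1) (j - 1) j i' j') := by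
  have hb := h
  simp only [StepBound.region, Finset.mem_product,
    Finset.mem_Icc] at hb
  refine .of_forall (boundaryValues_cyclicSum hsk)
    (boundaryZero_boxInd (by omega) (by omega) (by omega)
    (by omega) _) ?_ ?_ fun c a b hc hne => ?_
  · rw [stepDiff_cyclicSum hsk hk h]
    simp only [cyclicSlack]
    omega
  · simp only [stepDiff, StepBound.plus, StepBound.minus, boxInd]
    omega
  · rw [stepDiff_cyclicSum hsk hk hc]
    refine ⟨cyclicSlack_nonneg _ _ _ _ _, fun hneg => ?_⟩
    have hneg' := stepDiff_neg_boxInd_neg hneg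
    clear hneg h
    rcases c <;>
    simp only [StepBound.region, Finset.mem_insert, Prod.mk.injEq, Finset.mem_product,
      Finset.mem_Icc, reduceCtorEq, false_implies, true_implies] at hc hne <;>
    simp only [StepBound.plus, StepBound.minus] at hneg' <;>
    simp only [cyclicSlack] <;>
    omega

lemma isWitness_vertOddUpper {k m j s : ℕ} (hk : 3 ≤ k)
    (h : (m, j) ∈ StepBound.region k .vertOddUpper) (hsk : s < k)
    (hs : s + m = j ∨ s + m = j + k) :
    IsWitness k ⟨.vertOddUpper, m, j⟩
      (fun i' j' => cyclicSum k s (i' / 2) j' - 1 * boxInd (2 * m) (2 * m) j j i' j')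
      (fun i' j' => -1 * boxInd (2 * m - 2) (2 * m) (j - 1) (j + 1) i' j') := by
  have hb := h
  simp only [StepBound.region, Finset.mem_product,
    Finset.mem_Icc] at hb
  have hsub : ∀ c a b, (a, b) ∈ StepBound.region k c →
      stepDiff ⟨c, a, b⟩
        (fun i' j' => cyclicSum k s (i' / 2) j' - 1 * boxInd (2 * m) (2 * m) j j i' j') + c.offset =
        cyclicSlack k s c a b - stepDiff ⟨c, a, b⟩ (boxInd (2 * m) (2 * m) j j) := by
    intro c a b hc
    rw [← stepDiff_cyclicSum hsk hk hc]
    simp only [stepDiff]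
    ring
  have hsub_nonneg : ∀ c a b, (a, b) ∈ StepBound.region k c →
      (c = .vertOddUpper → ¬(a = m ∧ b = j)) →
      0 ≤ cyclicSlack k s c a b - stepDiff ⟨c, a, b⟩ (boxInd (2 * m) (2 * m) j j) := by
    intro c a b hc hne
    clear h
    rcases c <;>
    simp only [StepBound.region, Finset.mem_insert, Prod.mk.injEq, Finset.mem_product,
      Finset.mem_Icc, reduceCtorEq, false_implies, true_implies] at hc hne <;>
    simp only [cyclicSlack, stepDiff, StepBound.plus, StepBound.minus, boxInd] <;>
    omega
  refine .of_forall ((boundaryValues_cyclicSum hsk).sub (boundaryZero_boxInd (by omega) (by omega)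
    (by omega) (by omega) _))
    (boundaryZero_boxInd (by omega) (by omega) (by omega)
    (by omega) _) ?_ ?_ fun c a b hc hne => ?_
  · rw [hsub _ _ _ h]
    simp only [cyclicSlack, stepDiff, StepBound.plus, StepBound.minus, boxInd]
    omega
  · simp only [stepDiff, StepBound.plus, StepBound.minus, boxInd]
    omega
  · rw [hsub _ _ _ hc]
    refine ⟨hsub_nonneg c a b hc hne, fun hneg => ?_⟩
    have hneg' := stepDiff_neg_boxInd_neg hneg
    clear hneg h
    rcases c <;>
    simp only [StepBound.region, Finset.mem_insert, Prod.mk.injEq, Finset.mem_product,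
      Finset.mem_Icc, reduceCtorEq, false_implies, true_implies] at hc hne <;>
    simp only [StepBound.plus, StepBound.minus] at hneg' <;>
    simp only [cyclicSlack, stepDiff, StepBound.plus, StepBound.minus, boxInd] <;>
    omega

lemma exists_isWitness {k : ℕ} (hk : 3 ≤ k) {e : Σ _ : StepBound, ℕ × ℕ} (he : e ∈ facetIndex k) :
    ∃ z d, IsWitness k e z d := by
  obtain ⟨c, m, j⟩ := e
  replace he : (m, j) ∈ StepBound.region k c := by simpa [facetIndex] using he
  obtain ⟨hm, hmk, hj, hjk⟩ := mem_region_bounds hk he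
  rcases c
  · obtain ⟨s, hsk, hs⟩ : ∃ s < k, s + m + 1 = j ∨ s + m + 1 = j + k := by
      by_cases h : m + 1 ≤ j
      · exact ⟨j - (m + 1), by omega, by omega⟩
      · exact ⟨j + k - (m + 1), by omega, by omega⟩
    exact ⟨_, _, isWitness_horizEvenLower hk he hsk hs⟩
  · obtain ⟨s, hsk, hs⟩ : ∃ s < k, s + m + 2 = j ∨ s + m + 2 = j + k := by
      by_cases h : m + 2 ≤ j
      · exact ⟨j - (m + 2), by omega, by omega⟩
      · exact ⟨j + k - (m + 2), by omega, by omega⟩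
    exact ⟨_, _, isWitness_horizOddLower hk he hsk hs⟩
  · obtain ⟨s, hsk, hs⟩ : ∃ s < k, s + k + 2 = j + m ∨ s + 2 = j + m := by
      by_cases h : k + 2 ≤ j + m
      · exact ⟨j + m - (k + 2), by omega, by omega⟩
      · exact ⟨j + m - 2, by omega, by omega⟩
    exact ⟨_, _, isWitness_horizEvenUpper hk he hsk hs⟩
  · obtain ⟨s, hsk, hs⟩ : ∃ s < k, s + k + 1 = j + m ∨ s + 1 = j + m := by
      by_cases h : k + 1 ≤ j + m
      · exact ⟨j + m - (k + 1), by omega, by omega⟩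
      · exact ⟨j + m - 1, by omega, by omega⟩
    exact ⟨_, _, isWitness_horizOddUpper hk he hsk hs⟩
  · obtain ⟨s, hsk, hs⟩ : ∃ s < k, s + m = j ∨ s + m = j + k := by
      by_cases h : m ≤ j
      · exact ⟨j - m, by omega, by omega⟩
      · exact ⟨j + k - m, by omega, by omega⟩
    exact ⟨_, _, isWitness_vertOddLower hk he hsk hs⟩
  · have hb := he
    simp only [StepBound.region, Finset.mem_product, Finset.mem_Icc] at hb
    obtain ⟨s, hsk, hs⟩ : ∃ s < k, s + m = j + 1 ∨ s + m = j + 1 + k := by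
      by_cases h : m ≤ j + 1
      · exact ⟨j + 1 - m, by omega, by omega⟩
      · exact ⟨j + 1 + k - m, by omega, by omega⟩
    exact ⟨_, _, isWitness_vertEvenLower hk he hsk hs⟩
  · obtain ⟨s, hsk, hs⟩ : ∃ s < k, s + m = j ∨ s + m = j + k := by
      by_cases h : m ≤ j
      · exact ⟨j - m, by omega, by omega⟩
      · exact ⟨j + k - m, by omega, by omega⟩
    exact ⟨_, _, isWitness_vertEvenUpper hk he hsk hs⟩
  · obtain ⟨s, hsk, hs⟩ : ∃ s < k, s + m = j ∨ s + m = j + k := by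
      by_cases h : m ≤ j
      · exact ⟨j - m, by omega, by omega⟩
      · exact ⟨j + k - m, by omega, by omega⟩
    exact ⟨_, _, isWitness_vertOddUpper hk he hsk hs⟩

end Witnesses

section CornerSums

variable {n k : ℕ}

/-- The entry of a matrix at a pair of natural numbers, and `0` outside the matrix. -/
def entry (x : Fin n → Fin k → ℝ) (a b : ℕ) : ℝ :=
  if h : a < n ∧ b < k then x ⟨a, h.1⟩ ⟨b, h.2⟩ else 0

@[simp] lemma entry_val (x : Fin n → Fin k → ℝ) (a : Fin n) (b : Fin k) :
    entry x a b = x a b := by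
  simp [entry]

/-- The sum of the entries in the upper left `i × j` corner of a matrix. -/
def cornerSum (i j : ℕ) : (Fin n → Fin k → ℝ) →ₗ[ℝ] ℝ where
  toFun x := ∑ a ∈ Finset.range i, ∑ b ∈ Finset.range j, entry x a b
  map_add' x y := by
    simp only [← Finset.sum_add_distrib]
    refine Finset.sum_congr rfl fun a _ => Finset.sum_congr rfl fun b _ => ?_
    unfold entry
    split_ifs <;> simp
  map_smul' r x := by
    simp only [smul_eq_mul, Finset.mul_sum, RingHom.id_apply]
    refine Finset.sum_congr rfl fun a _ => Finset.sum_congr rfl fun b _ => ?_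
    unfold entry
    split_ifs <;> simp

lemma cornerSum_apply (i j : ℕ) (x : Fin n → Fin k → ℝ) :
    cornerSum i j x = ∑ a ∈ Finset.range i, ∑ b ∈ Finset.range j, entry x a b := rfl

@[simp] lemma cornerSum_zero_left (j : ℕ) (x : Fin n → Fin k → ℝ) : cornerSum 0 j x = 0 := by
  simp [cornerSum_apply]

@[simp] lemma cornerSum_zero_right (i : ℕ) (x : Fin n → Fin k → ℝ) : cornerSum i 0 x = 0 := by
  simp [cornerSum_apply]

lemma cornerSum_succ_left_sub (i j : ℕ) (x : Fin n → Fin k → ℝ) :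
    cornerSum (i + 1) j x - cornerSum i j x = ∑ b ∈ Finset.range j, entry x i b := by
  simp [cornerSum_apply, Finset.sum_range_succ]

lemma cornerSum_succ_right_sub (i j : ℕ) (x : Fin n → Fin k → ℝ) :
    cornerSum i (j + 1) x - cornerSum i j x = ∑ a ∈ Finset.range i, entry x a j := by
  simp [cornerSum_apply, Finset.sum_range_succ, Finset.sum_add_distrib]

/-- The matrix with given corner sums. -/
def blockOf (h : ℕ → ℕ → ℝ) (a : Fin n) (b : Fin k) : ℝ :=
  h (a + 1) (b + 1) - h a (b + 1) - (h (a + 1) b - h a b)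

lemma blockOf_cornerSum (x : Fin n → Fin k → ℝ) : blockOf (fun i j => cornerSum i j x) = x := by
  ext a b
  simp only [blockOf, cornerSum_succ_left_sub, Finset.sum_range_succ, entry_val]
  ring

lemma cornerSum_blockOf {h : ℕ → ℕ → ℝ} (h₁ : ∀ j ≤ k, h 0 j = 0) (h₂ : ∀ i, h i 0 = 0)
    {i j : ℕ} (hi : i ≤ n) (hj : j ≤ k) :
    cornerSum i j (blockOf h : Fin n → Fin k → ℝ) = h i j := by
  have hrow : ∀ a ∈ Finset.range i,
      ∑ b ∈ Finset.range j, entry (blockOf h : Fin n → Fin k → ℝ) a b = h (a + 1) j - h a j := by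
    intro a ha
    rw [Finset.mem_range] at ha
    calc _ = ∑ b ∈ Finset.range j, ((h (a + 1) (b + 1) - h a (b + 1)) - (h (a + 1) b - h a b)) := by
          refine Finset.sum_congr rfl fun b hb => ?_
          rw [Finset.mem_range] at hb
          rw [entry, dif_pos ⟨by omega, by omega⟩]
          rfl
      _ = _ := by rw [Finset.sum_range_sub fun b => h (a + 1) b - h a b]; simp [h₂]
  rw [cornerSum_apply, Finset.sum_congr rfl hrow, Finset.sum_range_sub fun a => h a j, h₁ j hj,
    sub_zero]

lemma cornerSum_congr_of_castLE {l : ℕ} (hkl : k ≤ l) (X : Fin n → Fin l → ℝ) (i : ℕ) {j : ℕ}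
    (hj : j ≤ k) : cornerSum i j (fun a (b : Fin k) => X a (Fin.castLE hkl b)) = cornerSum i j X := by
  rw [cornerSum_apply, cornerSum_apply]
  refine Finset.sum_congr rfl fun a _ => Finset.sum_congr rfl fun b hb => ?_
  rw [Finset.mem_range] at hb
  unfold entry
  by_cases ha : a < n
  · rw [dif_pos ⟨ha, by omega⟩, dif_pos ⟨ha, by omega⟩]
    rfl
  · rw [dif_neg (by omega), dif_neg (by omega)]

lemma sum_Iic_eq_sum_range {m : ℕ} (f : ℕ → ℝ) (j : Fin m) :
    ∑ j' ∈ Finset.Iic j, f j' = ∑ b ∈ Finset.range (j + 1), f b := by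
  have : Finset.range ((j : ℕ) + 1) = (Finset.Iic j).map Fin.valEmbedding := by
    rw [Fin.map_valEmbedding_Iic]
    ext
    simp
  rw [this, Finset.sum_map]
  rfl

lemma sum_Iic_row (x : Fin n → Fin k → ℝ) (i : Fin n) (j : Fin k) :
    ∑ j' ∈ Finset.Iic j, x i j' = cornerSum (i + 1) (j + 1) x - cornerSum i (j + 1) x := by
  rw [cornerSum_succ_left_sub, ← sum_Iic_eq_sum_range]
  simp

lemma sum_Iic_column (x : Fin n → Fin k → ℝ) (i : Fin n) (j : Fin k) :
    ∑ i' ∈ Finset.Iic i, x i' j = cornerSum (i + 1) (j + 1) x - cornerSum (i + 1) j x := by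
  rw [cornerSum_succ_right_sub, ← sum_Iic_eq_sum_range fun a => entry x a j]
  simp

lemma sum_row (x : Fin n → Fin k → ℝ) (i : Fin n) :
    ∑ j, x i j = cornerSum (i + 1) k x - cornerSum i k x := by
  rw [cornerSum_succ_left_sub, Finset.sum_range]
  simp

lemma sum_column (x : Fin n → Fin k → ℝ) (j : Fin k) :
    ∑ i, x i j = cornerSum n (j + 1) x - cornerSum n j x := by
  rw [cornerSum_succ_right_sub, Finset.sum_range fun a => entry x a j]
  simp

/-- All horizontal and vertical steps of an array belong to `s`. -/
def StepsIn (n k : ℕ) (s : Set ℝ) (h : ℕ → ℕ → ℝ) : Prop :=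
  (∀ i < n, ∀ j ≤ k, h (i + 1) j - h i j ∈ s) ∧ ∀ i ≤ n, ∀ j < k, h i (j + 1) - h i j ∈ s

/-- Alternating sign matrices in terms of their corner sums. -/
lemma isASM_iff (X : Fin n → Fin n → ℝ) :
    IsASM n X ↔ StepsIn n n {0, 1} (fun i j => cornerSum i j X) ∧
      (∀ i ≤ n, cornerSum i n X = i) ∧ ∀ j ≤ n, cornerSum n j X = j := by
  simp only [StepsIn, Set.mem_insert_iff, Set.mem_singleton_iff]
  constructor
  · rintro ⟨-, hrow, hcol, hrows, hcols⟩
    refine ⟨⟨fun i hi j hj => ?_, fun i hi j hj => ?_⟩, fun i hi => ?_, fun j hj => ?_⟩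
    · rcases j with _ | j
      · simp
      · simpa only [sum_Iic_row] using hrow ⟨i, hi⟩ ⟨j, hj⟩
    · rcases i with _ | i
      · simp
      · simpa only [sum_Iic_column] using hcol ⟨i, hi⟩ ⟨j, hj⟩
    · induction i with
      | zero => simp
      | succ i ih =>
        have := hrows ⟨i, hi⟩
        rw [sum_row, sub_eq_iff_eq_add, ih (by omega)] at this
        push_cast
        linarith
    · induction j with
      | zero => simp
      | succ j ih =>
        have := hcols ⟨j, hj⟩
        rw [sum_column, sub_eq_iff_eq_add, ih (by omega)] at this
        push_cast
        linarith
  · rintro ⟨⟨hv, hh⟩, hrows, hcols⟩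
    refine ⟨fun i j => ?_, fun i j => ?_, fun i j => ?_, fun i => ?_, fun j => ?_⟩
    · have h1 := hv i i.2 (j + 1) j.2
      have h2 := hv i i.2 j j.2.le
      rw [← congrFun₂ (blockOf_cornerSum X) i j, blockOf]
      rcases h1 with h1 | h1 <;> rcases h2 with h2 | h2 <;> rw [h1, h2] <;> norm_num
    · rw [sum_Iic_row]
      exact hv i i.2 _ j.2
    · rw [sum_Iic_column]
      exact hh _ i.2 j j.2
    · rw [sum_row, hrows _ i.2, hrows _ i.2.le]
      simp
    · rw [sum_column, hcols _ j.2, hcols _ j.2.le]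
      simp

end CornerSums

section SymmetricBlocks

variable {n k : ℕ}

/-- The left blocks of the vertically symmetric alternating sign matrices. -/
def symmetricBlocks (n k : ℕ) (hkn : k ≤ n) : Set (Fin n → Fin k → ℝ) :=
  (fun (X : Fin n → Fin n → ℝ) (i : Fin n) (j : Fin k) => X i (Fin.castLE hkn j)) ''
    {X | IsASM n X ∧ ∀ i j, X i j = X i j.rev}

lemma cornerSum_middle_of_symmetric (hn : n = 2 * k + 1) {X : Fin n → Fin n → ℝ}
    (hX : ∀ i j, X i j = X i j.rev) (i : ℕ) :
    cornerSum i (k + 1) X + cornerSum i k X = cornerSum i n X := by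
  simp only [cornerSum_apply, ← Finset.sum_add_distrib]
  refine Finset.sum_congr rfl fun a _ => ?_
  rw [show Finset.range n = Finset.range (k + 1 + k) by rw [hn]; congr 1; ring,
    Finset.sum_range_add _ (k + 1) k, ← Finset.sum_range_reflect _ k]
  congr 1
  refine Finset.sum_congr rfl fun b hb => ?_
  rw [Finset.mem_range] at hb
  unfold entry
  by_cases ha : a < n
  · rw [dif_pos ⟨ha, by omega⟩, dif_pos ⟨ha, by omega⟩, hX]
    congr 1
    ext
    simp only [Fin.val_rev]
    omega
  · rw [dif_neg (by omega), dif_neg (by omega)]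

lemma eq_half_of_steps {u : ℕ → ℝ} {N : ℕ} (h0 : u 0 = 0)
    (hstep : ∀ i < N, u (i + 1) = u i ∨ u (i + 1) = u i + 1)
    (hu : ∀ i ≤ N, (i : ℝ) = 2 * u i ∨ (i : ℝ) = 2 * u i + 1) {i : ℕ} (hi : i ≤ N) :
    u i = (i / 2 : ℕ) := by
  induction i with
  | zero => simpa using h0
  | succ i ih =>
    have ih := ih (by omega)
    have hs := hstep i hi
    have hu := hu _ hi
    rcases Nat.even_or_odd' i with ⟨c, rfl | rfl⟩
    · rw [show 2 * c / 2 = c by omega] at ih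
      rw [show (2 * c + 1) / 2 = c by omega]
      push_cast at hu
      rcases hs with hs | hs
      · rw [hs, ih]
      · rcases hu with hu | hu <;> linarith
    · rw [show (2 * c + 1) / 2 = c by omega] at ih
      rw [show (2 * c + 1 + 1) / 2 = c + 1 by omega]
      push_cast at hu ⊢
      rcases hs with hs | hs
      · rcases hu with hu | hu <;> linarith
      · rw [hs, ih]

/-- The boundary values of an array with steps in `[0, 1]` are determined by those of the last row
and the last column. -/
lemma StepsIn.boundaryValues {h : ℕ → ℕ → ℝ} (hh : StepsIn (2 * k + 1) k (Set.Icc 0 1) h)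
    (h0 : ∀ j, h 0 j = 0) (h0' : ∀ i, h i 0 = 0) (hk : ∀ i ≤ 2 * k + 1, h i k = (i / 2 : ℕ))
    (hn : ∀ j ≤ k, h (2 * k + 1) j = j) : BoundaryValues k h := by
  have hmono : ∀ i ≤ 2 * k + 1, ∀ d ≤ k, 0 ≤ h i k - h i (k - d) ∧ h i k - h i (k - d) ≤ d := by
    intro i hi d hd
    induction d with
    | zero => simp
    | succ d ih =>
      have ih := ih (by omega)
      have hs := hh.2 i hi (k - (d + 1)) (by omega)
      rw [show k - (d + 1) + 1 = k - d by omega, Set.mem_Icc] at hs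
      push_cast
      constructor <;> linarith
  have hmono' : ∀ i ≤ 2 * k + 1, ∀ j ≤ k, 0 ≤ h i j ∧ h i j ≤ j := by
    intro i hi j hj
    induction j with
    | zero => simp [h0']
    | succ j ih =>
      have ih := ih (by omega)
      have hs := hh.2 i hi j (by omega)
      rw [Set.mem_Icc] at hs
      push_cast
      constructor <;> linarith
  refine ⟨h0', hk, fun j hj => ⟨h0 j, ?_, ?_, hn j hj⟩⟩
  · have h1 := hmono 1 (by omega) (k - j) (by omega)
    have h2 := hmono' 1 (by omega) j hj
    rw [Nat.sub_sub_self hj, hk 1 (by omega)] at h1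
    simp only [Nat.reduceDiv, Nat.cast_zero] at h1
    linarith
  · have h1 := hmono (2 * k) (by omega) (k - j) (by omega)
    have h2 := hmono' (2 * k) (by omega) j hj
    rw [Nat.sub_sub_self hj, hk _ (by omega), show 2 * k / 2 = k by omega, Nat.cast_sub hj] at h1
    linarith

lemma steps_of_mem_symmetricBlocks (hn : n = 2 * k + 1) (hkn : k ≤ n) {x : Fin n → Fin k → ℝ}
    (hx : x ∈ symmetricBlocks n k hkn) :
    BoundaryValues k (fun i j => cornerSum i j x) ∧
      StepsIn n k (Set.Icc 0 1) (fun i j => cornerSum i j x) := by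
  obtain ⟨X, ⟨hX, hsymm⟩, rfl⟩ := hx
  rw [isASM_iff] at hX
  obtain ⟨⟨hv, hh⟩, hrows, hcols⟩ := hX
  have hval : ∀ i, ∀ j ≤ k,
      cornerSum i j (fun a (b : Fin k) => X a (Fin.castLE hkn b)) = cornerSum i j X :=
    fun i j hj => cornerSum_congr_of_castLE hkn X i hj
  have hIcc : ∀ r : ℝ, r ∈ ({0, 1} : Set ℝ) → r ∈ Set.Icc (0 : ℝ) 1 := by
    rintro r (rfl | rfl) <;> simp
  have hsteps : StepsIn n k (Set.Icc 0 1)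
      fun i j => cornerSum i j (fun a (b : Fin k) => X a (Fin.castLE hkn b)) := by
    refine ⟨fun i hi j hj => ?_, fun i hi j hj => ?_⟩
    · beta_reduce
      rw [hval _ _ hj, hval _ _ hj]
      exact hIcc _ (hv i hi j (by omega))
    · beta_reduce
      rw [hval _ _ hj, hval _ _ hj.le]
      exact hIcc _ (hh i hi j (by omega))
  refine ⟨?_, hsteps⟩
  refine StepsIn.boundaryValues (hn ▸ hsteps) (by simp) (by simp) (fun i hi => ?_) fun j hj => ?_
  · rw [hval i k le_rfl]
    refine eq_half_of_steps (u := fun i => cornerSum i k X) (by simp) (fun i hi => ?_)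
      (fun i hi => ?_) hi
    · rcases hv i (by omega) k hkn with h | h
      · exact Or.inl (sub_eq_zero.1 h)
      · exact Or.inr (by linarith [Set.mem_singleton_iff.1 h])
    · have h1 := cornerSum_middle_of_symmetric hn hsymm i
      rw [hrows i (by omega)] at h1
      rcases hh i (by omega) k (by omega) with h | h
      · exact Or.inl (by linarith)
      · exact Or.inr (by linarith [Set.mem_singleton_iff.1 h])
  · rw [hval _ j hj, ← hn, hcols j (by omega)]

/-- An integral array with the right boundary values and steps is the array of corner sums of the
left block of a vertically symmetric alternating sign matrix. -/
lemma blockOf_mem_symmetricBlocks (hn : n = 2 * k + 1) (hkn : k ≤ n) {h : ℕ → ℕ → ℝ}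
    (hb : BoundaryValues k h) (hs : StepsIn n k {0, 1} h) :
    blockOf h ∈ symmetricBlocks n k hkn := by
  have hb2 := hb.2.1
  have hb3 := hb.2.2
  rw [← hn] at hb2 hb3
  let H : ℕ → ℕ → ℝ := fun i j => if j ≤ k then h i j else i - h i (n - j)
  have H1 : ∀ i j, j ≤ k → H i j = h i j := fun i j hj => if_pos hj
  have H2 : ∀ i j, k < j → H i j = i - h i (n - j) := fun i j hj => if_neg (by omega)
  have hrefl : ∀ i j, j ≤ n → H i j = i - H i (n - j) := by
    intro i j hj
    rcases le_or_gt j k with hjk | hjk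
    · rw [H1 i j hjk, H2 i (n - j) (by omega), show n - (n - j) = j by omega]
      ring
    · rw [H2 i j hjk, H1 i (n - j) (by omega)]
  have hcs : ∀ i ≤ n, ∀ j ≤ n, cornerSum i j (blockOf H : Fin n → Fin n → ℝ) = H i j := by
    intro i hi j hj
    refine cornerSum_blockOf (fun j hj => ?_) (fun i => ?_) hi hj
    · rcases le_or_gt j k with hjk | hjk
      · rw [H1 0 j hjk, (hb3 j hjk).1]
      · rw [H2 0 j hjk, (hb3 (n - j) (by omega)).1]
        simp
    · rw [H1 i 0 (by omega), hb.1]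
  have hone : ∀ r : ℝ, r ∈ ({0, 1} : Set ℝ) → 1 - r ∈ ({0, 1} : Set ℝ) := by
    rintro r (rfl | rfl) <;> simp
  refine ⟨blockOf H, ⟨(isASM_iff _).2 ⟨⟨fun i hi j hj => ?_, fun i hi j hj => ?_⟩,
    fun i hi => ?_, fun j hj => ?_⟩, fun i j => ?_⟩, ?_⟩
  · beta_reduce
    rw [hcs _ hi j hj, hcs i hi.le j hj]
    rcases le_or_gt j k with hjk | hjk
    · rw [H1 _ _ hjk, H1 _ _ hjk]
      exact hs.1 i hi j hjk
    · rw [H2 _ _ hjk, H2 _ _ hjk]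
      convert hone _ (hs.1 i hi (n - j) (by omega)) using 1
      push_cast
      ring
  · beta_reduce
    rw [hcs i hi _ hj, hcs i hi j hj.le]
    rcases lt_trichotomy j k with hjk | rfl | hjk
    · rw [H1 _ _ hjk, H1 _ _ hjk.le]
      exact hs.2 i hi j hjk
    · rw [H1 _ _ le_rfl, H2 _ _ (by omega), show n - (j + 1) = j by omega, hb2 i hi]
      rcases Nat.even_or_odd' i with ⟨c, rfl | rfl⟩
      · rw [show 2 * c / 2 = c by omega]
        left
        push_cast
        ring
      · rw [show (2 * c + 1) / 2 = c by omega]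
        right
        rw [Set.mem_singleton_iff]
        push_cast
        ring
    · rw [H2 _ _ hjk, H2 _ _ (by omega)]
      convert hs.2 i hi (n - (j + 1)) (by omega) using 1
      rw [show n - (j + 1) + 1 = n - j by omega]
      ring
  · rw [hcs i hi n le_rfl, H2 i n (by omega), Nat.sub_self, hb.1, sub_zero]
  · rw [hcs n le_rfl j hj]
    rcases le_or_gt j k with hjk | hjk
    · rw [H1 n j hjk, (hb3 j hjk).2.2.2]
    · rw [H2 n j hjk, (hb3 (n - j) (by omega)).2.2.2, Nat.cast_sub hj]
      ring
  · have hj := j.2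
    simp only [blockOf, Fin.val_rev]
    rw [hrefl _ (n - (↑j + 1) + 1) (by omega), hrefl _ (n - (↑j + 1) + 1) (by omega),
      hrefl _ (n - (↑j + 1)) (by omega), hrefl _ (n - (↑j + 1)) (by omega),
      show n - (n - ((j : ℕ) + 1) + 1) = j by omega, show n - (n - ((j : ℕ) + 1)) = j + 1 by omega]
    ring
  · ext i j
    simp only [blockOf, Fin.val_castLE]
    rw [H1 _ _ (by omega), H1 _ _ (by omega), H1 _ _ (by omega), H1 _ _ (by omega)]

end SymmetricBlocks

section Rounding

open MeasureTheory

variable {n k : ℕ}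

lemma floor_add_eq_of_mem_Ico (x : ℝ) {t : ℝ} (ht : t ∈ Set.Ico (0 : ℝ) 1) :
    (⌊x + t⌋ : ℝ) = ⌊x⌋ + (Set.Ici (1 - Int.fract x)).indicator 1 t := by
  obtain ⟨h0, h1⟩ := ht
  have hx := Int.floor_add_fract x
  have hf0 := Int.fract_nonneg x
  have hf1 := Int.fract_lt_one x
  by_cases h : 1 - Int.fract x ≤ t
  · rw [Set.indicator_of_mem (by exact h)]
    have : ⌊x + t⌋ = ⌊x⌋ + 1 := by
      rw [Int.floor_eq_iff]
      push_cast
      constructor <;> linarith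
    rw [this]
    simp
  · rw [Set.indicator_of_notMem (by exact h), add_zero, Int.cast_inj, Int.floor_eq_iff]
    constructor <;> linarith

lemma integrableOn_floor_add (x : ℝ) :
    IntegrableOn (fun t => (⌊x + t⌋ : ℝ)) (Set.Ico 0 1) := by
  refine IntegrableOn.congr_fun (f := fun t =>
    (⌊x⌋ : ℝ) + (Set.Ici (1 - Int.fract x)).indicator 1 t) ?_
    (fun t ht => (floor_add_eq_of_mem_Ico x ht).symm) measurableSet_Ico
  exact (integrable_const _).add ((integrable_const 1).indicator measurableSet_Ici)

/-- Randomized rounding is unbiased. -/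
lemma setIntegral_floor_add (x : ℝ) : ∫ t in Set.Ico (0 : ℝ) 1, (⌊x + t⌋ : ℝ) = x := by
  rw [setIntegral_congr_fun measurableSet_Ico fun t ht => floor_add_eq_of_mem_Ico x ht,
    integral_add (integrable_const _) ((integrable_const 1).indicator measurableSet_Ici),
    integral_indicator_one measurableSet_Ici, measureReal_restrict_apply measurableSet_Ici]
  have hf0 := Int.fract_nonneg x
  have hset : Set.Ici (1 - Int.fract x) ∩ Set.Ico 0 1 = Set.Ico (1 - Int.fract x) 1 := by
    ext t
    have hf1 := Int.fract_lt_one x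
    simp only [Set.mem_inter_iff, Set.mem_Ici, Set.mem_Ico]
    exact ⟨fun h => ⟨h.1, h.2.2⟩, fun h => ⟨h.1, by linarith, h.2⟩⟩
  rw [hset, Real.volume_real_Ico_of_le (by linarith)]
  simp

lemma finite_symmetricBlocks (hkn : k ≤ n) : (symmetricBlocks n k hkn).Finite := by
  refine (Set.Finite.subset ?_ fun X hX => hX.1.1).image _
  exact Set.Finite.pi' fun _ => Set.Finite.pi' fun _ => Set.toFinite {-1, 0, 1}

lemma floor_add_sub_mem {x y t : ℝ} (h : y - x ∈ Set.Icc (0 : ℝ) 1) :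
    (⌊y + t⌋ : ℝ) - ⌊x + t⌋ ∈ ({0, 1} : Set ℝ) := by
  have h0 : ⌊x + t⌋ ≤ ⌊y + t⌋ := Int.floor_mono (by linarith [h.1])
  have h1 : ⌊y + t⌋ ≤ ⌊x + t⌋ + 1 := by
    rw [← Int.floor_add_one]
    exact Int.floor_mono (by linarith [h.2])
  rcases (by omega : ⌊y + t⌋ = ⌊x + t⌋ ∨ ⌊y + t⌋ = ⌊x + t⌋ + 1) with h | h <;> rw [h] <;> simp

lemma floor_natCast_add (m : ℕ) {t : ℝ} (ht : t ∈ Set.Ico (0 : ℝ) 1) :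
    (⌊(m : ℝ) + t⌋ : ℝ) = m := by
  rw [Int.floor_natCast_add, Int.floor_eq_zero_iff.2 ht]
  simp

lemma mem_convexHull_symmetricBlocks (hn : n = 2 * k + 1) (hkn : k ≤ n) {x : Fin n → Fin k → ℝ}
    (hb : BoundaryValues k fun i j => cornerSum i j x)
    (hs : StepsIn n k (Set.Icc 0 1) fun i j => cornerSum i j x) :
    x ∈ convexHull ℝ (symmetricBlocks n k hkn) := by
  let μ : Measure ℝ := volume.restrict (Set.Ico 0 1)
  have : IsProbabilityMeasure μ := ⟨by simp [μ]⟩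
  let f : ℝ → Fin n → Fin k → ℝ := fun t => blockOf fun i j => (⌊cornerSum i j x + t⌋ : ℝ)
  have hf : ∀ᵐ t ∂μ, f t ∈ convexHull ℝ (symmetricBlocks n k hkn) := by
    filter_upwards [ae_restrict_mem measurableSet_Ico] with t ht
    refine subset_convexHull ℝ _ (blockOf_mem_symmetricBlocks hn hkn ⟨fun i => ?_, fun i hi => ?_,
      fun j hj => ?_⟩ ⟨fun i hi j hj => ?_, fun i hi j hj => ?_⟩)
    · simpa using floor_natCast_add 0 ht
    · have h := hb.2.1 i hi
      beta_reduce at h ⊢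
      rw [h, floor_natCast_add _ ht]
    · obtain ⟨h1, h2, h3, h4⟩ := hb.2.2 j hj
      beta_reduce at h1 h2 h3 h4 ⊢
      rw [h1, h2, h3, h4, floor_natCast_add _ ht]
      simpa using floor_natCast_add 0 ht
    · exact floor_add_sub_mem (hs.1 i hi j hj)
    · exact floor_add_sub_mem (hs.2 i hi j hj)
  have hint : ∀ i j, Integrable (fun t => (⌊cornerSum i j x + t⌋ : ℝ)) μ :=
    fun i j => integrableOn_floor_add _
  have hval : ∀ i j, ∫ t, (⌊cornerSum i j x + t⌋ : ℝ) ∂μ = cornerSum i j x :=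
    fun i j => setIntegral_floor_add _
  have hsub : ∀ i j i' j',
      Integrable (fun t => (⌊cornerSum i j x + t⌋ : ℝ) - ⌊cornerSum i' j' x + t⌋) μ :=
    fun i j i' j' => (hint i j).sub (hint i' j')
  have hfi : ∀ a b, Integrable (fun t => f t a b) μ := fun a b =>
    (hsub _ _ _ _).sub (hsub _ _ _ _)
  have hfint : Integrable f μ := Integrable.of_eval fun a => Integrable.of_eval fun b => hfi a b
  have hmem := (convex_convexHull ℝ (symmetricBlocks n k hkn)).integral_mem
    ((finite_symmetricBlocks hkn).isClosed_convexHull ℝ) hf hfint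
  convert hmem using 1
  ext a b
  rw [eval_integral fun a => Integrable.of_eval fun b => hfi a b, eval_integral fun b => hfi a b]
  simp only [f, blockOf]
  rw [integral_sub (hsub _ _ _ _) (hsub _ _ _ _),
    integral_sub (hint _ _) (hint _ _), integral_sub (hint _ _) (hint _ _)]
  simp only [hval]
  exact (congrFun₂ (blockOf_cornerSum x) a b).symm

end Rounding

section Redundancy

/-- The facet-defining inequalities together with the boundary conditions, for the even rows `a` and
the odd rows `b` of an array. -/
structure FacetBounds (k : ℕ) (a b : ℕ → ℕ → ℝ) : Prop where
  left : ∀ m, a m 0 = 0 ∧ b m 0 = 0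
  right : ∀ m ≤ k, a m k = m ∧ b m k = m
  top : ∀ j ≤ k, a 0 j = 0 ∧ b 0 j = 0
  bottom : ∀ j ≤ k, a k j = j ∧ b k j = j
  horizEvenLower_corner : 0 ≤ a 1 1
  horizEvenLower : ∀ m j, 1 ≤ m → m + 2 ≤ k → 1 ≤ j → j + 2 ≤ k → a m j ≤ a m (j + 1)
  horizOddLower : ∀ m j, 1 ≤ m → m + 2 ≤ k → 1 ≤ j → j + 1 ≤ k → b m j ≤ b m (j + 1)
  horizEvenUpper : ∀ m j, 2 ≤ m → m + 1 ≤ k → 1 ≤ j → j + 1 ≤ k → a m (j + 1) ≤ a m j + 1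
  horizOddUpper_corner : b (k - 1) 1 ≤ 1
  horizOddUpper : ∀ m j, 2 ≤ m → m + 1 ≤ k → 1 ≤ j → j + 2 ≤ k → b m (j + 1) ≤ b m j + 1
  vertOddLower : ∀ m j, 1 ≤ m → m + 1 ≤ k → 1 ≤ j → j + 1 ≤ k → a m j ≤ b m j
  vertEvenLower : ∀ m j, 1 ≤ m → m + 2 ≤ k → 1 ≤ j → j + 2 ≤ k → b m j ≤ a (m + 1) j
  vertEvenUpper : ∀ m j, 1 ≤ m → m + 2 ≤ k → 2 ≤ j → j + 1 ≤ k → a (m + 1) j ≤ b m j + 1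
  vertOddUpper : ∀ m j, 2 ≤ m → m + 2 ≤ k → 2 ≤ j → j + 2 ≤ k → b m j ≤ a m j + 1

namespace FacetBounds

variable {k m j : ℕ} {a b : ℕ → ℕ → ℝ}

/-- Turning the array upside down. -/
lemma symm (hk : 3 ≤ k) (h : FacetBounds k a b) :
    FacetBounds k (fun m j => j - b (k - m) j) (fun m j => j - a (k - m) j) where
  left m := by simp [h.left]
  right m hm := by
    rw [(h.right _ (Nat.sub_le k m)).1, (h.right _ (Nat.sub_le k m)).2, Nat.cast_sub hm]
    simp
  top j hj := by simp [h.bottom j hj]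
  bottom j hj := by simp [h.top j hj]
  horizEvenLower_corner := by simpa using h.horizOddUpper_corner
  horizEvenLower m j h1 h2 h3 h4 := by
    have := h.horizOddUpper (k - m) j (by omega) (by omega) h3 h4
    push_cast
    linarith
  horizOddLower m j h1 h2 h3 h4 := by
    have := h.horizEvenUpper (k - m) j (by omega) (by omega) h3 h4
    push_cast
    linarith
  horizEvenUpper m j h1 h2 h3 h4 := by
    have := h.horizOddLower (k - m) j (by omega) (by omega) h3 h4
    push_cast
    linarith
  horizOddUpper_corner := by
    rw [show k - (k - 1) = 1 by omega]
    simpa using h.horizEvenLower_corner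
  horizOddUpper m j h1 h2 h3 h4 := by
    have := h.horizEvenLower (k - m) j (by omega) (by omega) h3 h4
    push_cast
    linarith
  vertOddLower m j h1 h2 h3 h4 := by
    have := h.vertOddLower (k - m) j (by omega) (by omega) h3 h4
    linarith
  vertEvenLower m j h1 h2 h3 h4 := by
    have := h.vertEvenLower (k - (m + 1)) j (by omega) (by omega) h3 h4
    rw [show k - (m + 1) + 1 = k - m by omega] at this
    linarith
  vertEvenUpper m j h1 h2 h3 h4 := by
    have := h.vertEvenUpper (k - (m + 1)) j (by omega) (by omega) h3 h4
    rw [show k - (m + 1) + 1 = k - m by omega] at this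
    linarith
  vertOddUpper m j h1 h2 h3 h4 := by
    have := h.vertOddUpper (k - m) j (by omega) (by omega) h3 h4
    linarith

lemma even_first_nonneg (hk : 3 ≤ k) (h : FacetBounds k a b) (h1 : 1 ≤ m) (h2 : m + 1 ≤ k) :
    0 ≤ a m 1 := by
  induction m, h1 using Nat.le_induction with
  | base => exact h.horizEvenLower_corner
  | succ m hm ih =>
    have := ih (by omega)
    have := h.vertOddLower m 1 hm (by omega) le_rfl (by omega)
    have := h.vertEvenLower m 1 hm (by omega) le_rfl (by omega)
    linarith

lemma odd_first_le (hk : 3 ≤ k) (h : FacetBounds k a b) (h1 : 1 ≤ m) (h2 : m + 1 ≤ k) :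
    b m 1 ≤ 1 := by
  have := (h.symm hk).even_first_nonneg hk (m := k - m) (by omega) (by omega)
  rw [Nat.sub_sub_self (by omega)] at this
  push_cast at this
  linarith

lemma odd_last_le (hk : 3 ≤ k) (h : FacetBounds k a b) (hj : j ≤ k) : b (k - 1) j ≤ j := by
  induction j with
  | zero => simp [h.left]
  | succ j ih =>
    rcases Nat.eq_zero_or_pos j with rfl | hj0
    · simpa using h.horizOddUpper_corner
    · rcases hj.eq_or_lt with rfl | hlt
      · rw [(h.right _ (by omega)).2]
        exact_mod_cast Nat.sub_le _ _
      · have := h.horizOddUpper (k - 1) j (by omega) (by omega) hj0 hlt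
        have := ih (by omega)
        push_cast
        linarith

lemma le_even_last (hk : 3 ≤ k) (h : FacetBounds k a b) (hj0 : 1 ≤ j) (hj : j ≤ k) :
    (j : ℝ) - 1 ≤ a (k - 1) j := by
  induction hj using Nat.decreasingInduction with
  | self => rw [(h.right _ (by omega)).1, Nat.cast_sub (by omega), Nat.cast_one]
  | of_succ j hj ih =>
    have := h.horizEvenUpper (k - 1) j (by omega) (by omega) hj0 (by omega)
    have := ih (by omega)
    push_cast at this
    linarith

lemma even_one_nonneg (hk : 3 ≤ k) (h : FacetBounds k a b) (hj : j ≤ k) : 0 ≤ a 1 j := by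
  have := (h.symm hk).odd_last_le hk hj
  rw [Nat.sub_sub_self (by omega)] at this
  linarith

lemma odd_one_le (hk : 3 ≤ k) (h : FacetBounds k a b) (hj : j ≤ k) : b 1 j ≤ 1 := by
  rcases Nat.eq_zero_or_pos j with rfl | hj0
  · simp [h.left]
  · have := (h.symm hk).le_even_last hk hj0 hj
    rw [Nat.sub_sub_self (by omega)] at this
    linarith

lemma vertOdd_nonneg (h : FacetBounds k a b) (hm : m ≤ k) (hj : j ≤ k) : a m j ≤ b m j := by
  rcases Nat.eq_zero_or_pos j with rfl | hj0
  · simp [h.left]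
  rcases hj.eq_or_lt with rfl | hjk
  · simp [h.right m hm]
  rcases Nat.eq_zero_or_pos m with rfl | hm0
  · simp [h.top j hj]
  rcases hm.eq_or_lt with rfl | hmk
  · simp [h.bottom j hj]
  exact h.vertOddLower m j hm0 hmk hj0 hjk

lemma odd_lastColumn_le (h : FacetBounds k a b) (h1 : 1 ≤ m) (h2 : m + 2 ≤ k) (hj : j + 1 = k)
    (hj0 : 1 ≤ j) : b m j ≤ m := by
  have := h.horizOddLower m j h1 h2 hj0 (by omega)
  rwa [hj, (h.right m (by omega)).2] at this

lemma le_even_lastColumn (h : FacetBounds k a b) (h1 : 2 ≤ m) (h2 : m + 1 ≤ k) (hj : j + 1 = k)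
    (hj0 : 1 ≤ j) : m - 1 ≤ a m j := by
  have := h.horizEvenUpper m j h1 h2 hj0 (by omega)
  rw [hj, (h.right m (by omega)).1] at this
  linarith

lemma horizEven_nonneg (hk : 3 ≤ k) (h : FacetBounds k a b) (hm : m ≤ k) (hj : j < k) :
    a m j ≤ a m (j + 1) := by
  rcases Nat.eq_zero_or_pos m with rfl | hm0
  · simp [(h.top j hj.le).1, (h.top (j + 1) hj).1]
  rcases hm.eq_or_lt with rfl | hmk
  · simp [(h.bottom j hj.le).1, (h.bottom (j + 1) hj).1]
  rcases Nat.eq_zero_or_pos j with rfl | hj0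
  · simpa [h.left] using h.even_first_nonneg hk hm0 hmk
  rcases Nat.lt_or_ge (m + 1) k with hmk' | hmk'
  · rcases Nat.lt_or_ge (j + 1) k with hjk | hjk
    · exact h.horizEvenLower m j hm0 hmk' hj0 hjk
    · obtain rfl : k = j + 1 := by omega
      rw [(h.right m hm).1]
      exact (h.vertOddLower m j hm0 hmk hj0 le_rfl).trans (h.odd_lastColumn_le hm0 hmk' rfl hj0)
  · obtain rfl : m = k - 1 := by omega
    have h1 := h.odd_last_le hk hj.le
    have h2 := h.le_even_last hk (j := j + 1) (by omega) hj
    have h3 := h.vertOddLower (k - 1) j hm0 hmk hj0 hj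
    push_cast at h2
    linarith

lemma horizOdd_nonneg (hk : 3 ≤ k) (h : FacetBounds k a b) (hm : m ≤ k) (hj : j < k) :
    b m j ≤ b m (j + 1) := by
  rcases Nat.eq_zero_or_pos m with rfl | hm0
  · simp [(h.top j hj.le).2, (h.top (j + 1) hj).2]
  rcases hm.eq_or_lt with rfl | hmk
  · simp [(h.bottom j hj.le).2, (h.bottom (j + 1) hj).2]
  rcases Nat.eq_zero_or_pos j with rfl | hj0
  · have := h.even_first_nonneg hk hm0 hmk
    have := h.vertOddLower m 1 hm0 hmk le_rfl (by omega)
    rw [(h.left m).2]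
    linarith
  rcases Nat.lt_or_ge (m + 1) k with hmk' | hmk'
  · exact h.horizOddLower m j hm0 hmk' hj0 hj
  · obtain rfl : m = k - 1 := by omega
    have h1 := h.odd_last_le hk hj.le
    have h2 := h.le_even_last hk (j := j + 1) (by omega) hj
    have h3 := h.vertOdd_nonneg hm (j := j + 1) hj
    push_cast at h2
    linarith

lemma horizEven_le (hk : 3 ≤ k) (h : FacetBounds k a b) (hm : m ≤ k) (hj : j < k) :
    a m (j + 1) ≤ a m j + 1 := by
  have := (h.symm hk).horizOdd_nonneg hk (m := k - m) (by omega) hj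
  rw [Nat.sub_sub_self hm] at this
  push_cast at this
  linarith

lemma horizOdd_le (hk : 3 ≤ k) (h : FacetBounds k a b) (hm : m ≤ k) (hj : j < k) :
    b m (j + 1) ≤ b m j + 1 := by
  have := (h.symm hk).horizEven_nonneg hk (m := k - m) (by omega) hj
  rw [Nat.sub_sub_self hm] at this
  push_cast at this
  linarith

lemma vertEven_nonneg (hk : 3 ≤ k) (h : FacetBounds k a b) (hm : m < k) (hj : j ≤ k) :
    b m j ≤ a (m + 1) j := by
  rcases Nat.eq_zero_or_pos j with rfl | hj0
  · simp [h.left]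
  rcases hj.eq_or_lt with rfl | hjk
  · simp [(h.right m hm.le).2, (h.right (m + 1) hm).1]
  rcases Nat.eq_zero_or_pos m with rfl | hm0
  · rw [(h.top j hj).2]
    exact h.even_one_nonneg hk hj
  rcases Nat.lt_or_ge (m + 1) k with hmk | hmk
  · rcases Nat.lt_or_ge (j + 1) k with hjk' | hjk'
    · exact h.vertEvenLower m j hm0 hmk hj0 hjk'
    · have h1 := h.odd_lastColumn_le hm0 hmk (j := j) (by omega) hj0
      have h2 := h.le_even_lastColumn (m := m + 1) (j := j) (by omega) hmk (by omega) hj0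
      push_cast at h2
      linarith
  · obtain rfl : k = m + 1 := by omega
    rw [(h.bottom j hj).1]
    exact h.odd_last_le hk hj

lemma vertEven_le (hk : 3 ≤ k) (h : FacetBounds k a b) (hm : m < k) (hj : j ≤ k) :
    a (m + 1) j ≤ b m j + 1 := by
  rcases Nat.eq_zero_or_pos j with rfl | hj0
  · simp [h.left]
  rcases hj.eq_or_lt with rfl | hjk
  · simp [(h.right m hm.le).2, (h.right (m + 1) hm).1]
  rcases Nat.eq_zero_or_pos m with rfl | hm0
  · rw [(h.top j hj).2, zero_add, zero_add]
    exact (h.vertOddLower 1 j le_rfl (by omega) hj0 hjk).trans (h.odd_one_le hk hj)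
  rcases Nat.lt_or_ge (m + 1) k with hmk | hmk
  · rcases Nat.eq_or_lt_of_le hj0 with rfl | hj1
    · have h1 := h.even_first_nonneg hk hm0 hm
      have h2 := h.vertOddLower m 1 hm0 hm le_rfl hjk
      have h3 := h.odd_first_le hk (m := m + 1) (by omega) hmk
      have h4 := h.vertOddLower (m + 1) 1 (by omega) hmk le_rfl hjk
      linarith
    · exact h.vertEvenUpper m j hm0 hmk hj1 hjk
  · obtain rfl : k = m + 1 := by omega
    have h1 := h.le_even_last hk hj0 hj
    have h2 := h.vertOddLower m j hm0 le_rfl hj0 hjk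
    rw [Nat.add_sub_cancel] at h1
    rw [(h.bottom j hj).1]
    linarith

lemma vertOdd_le (hk : 3 ≤ k) (h : FacetBounds k a b) (hm : m ≤ k) (hj : j ≤ k) :
    b m j ≤ a m j + 1 := by
  rcases Nat.eq_zero_or_pos j with rfl | hj0
  · simp [h.left]
  rcases hj.eq_or_lt with rfl | hjk
  · simp [h.right m hm]
  rcases Nat.eq_zero_or_pos m with rfl | hm0
  · simp [h.top j hj]
  rcases hm.eq_or_lt with rfl | hmk
  · simp [h.bottom j hj]
  rcases Nat.eq_or_lt_of_le hm0 with rfl | hm1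
  · have h1 := h.odd_one_le hk hj
    have h2 := h.even_one_nonneg hk hj
    change b 1 j ≤ a 1 j + 1
    linarith
  rcases Nat.lt_or_ge (m + 1) k with hmk' | hmk'
  · rcases Nat.eq_or_lt_of_le hj0 with rfl | hj1
    · have h1 := h.odd_first_le hk hm0 hmk
      have h2 := h.even_first_nonneg hk hm0 hmk
      change b m 1 ≤ a m 1 + 1
      linarith
    rcases Nat.lt_or_ge (j + 1) k with hjk' | hjk'
    · exact h.vertOddUpper m j hm1 hmk' hj1 hjk'
    · have h1 := h.odd_lastColumn_le hm0 hmk' (j := j) (by omega) hj0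
      have h2 := h.le_even_lastColumn (j := j) hm1 hmk (by omega) hj0
      linarith
  · obtain rfl : m = k - 1 := by omega
    have h1 := h.odd_last_le hk hj
    have h2 := h.le_even_last hk hj0 hj
    linarith

end FacetBounds

lemma facetBounds_of_stepDiff {k : ℕ} (hk : 3 ≤ k) {h : ℕ → ℕ → ℝ} (hb : BoundaryValues k h)
    (hf : ∀ c ∈ facetIndex k, 0 ≤ stepDiff c h + c.1.offset) :
    FacetBounds k (fun m => h (2 * m)) (fun m => h (2 * m + 1)) := by
  have hf' : ∀ (c : StepBound) (m j : ℕ), (m, j) ∈ c.region k →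
      0 ≤ stepDiff ⟨c, m, j⟩ h + c.offset :=
    fun c m j hc => hf ⟨c, m, j⟩ (by simpa [facetIndex] using hc)
  refine ⟨fun m => ⟨hb.1 _, hb.1 _⟩, fun m hm => ⟨?_, ?_⟩, fun j hj => ⟨(hb.2.2 j hj).1, ?_⟩,
    fun j hj => ⟨(hb.2.2 j hj).2.2.1, (hb.2.2 j hj).2.2.2⟩, ?_, fun m j h1 h2 h3 h4 => ?_,
    fun m j h1 h2 h3 h4 => ?_, fun m j h1 h2 h3 h4 => ?_, ?_, fun m j h1 h2 h3 h4 => ?_,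
    fun m j h1 h2 h3 h4 => ?_, fun m j h1 h2 h3 h4 => ?_, fun m j h1 h2 h3 h4 => ?_,
    fun m j h1 h2 h3 h4 => ?_⟩
  · rw [hb.2.1 _ (by omega), show 2 * m / 2 = m by omega]
  · rw [hb.2.1 _ (by omega), show (2 * m + 1) / 2 = m by omega]
  · exact (hb.2.2 j hj).2.1
  · have := hf' .horizEvenLower 1 1 (by simp [StepBound.region])
    simpa [stepDiff, StepBound.plus, StepBound.minus, StepBound.offset, hb.1] using this
  · have := hf' .horizEvenLower m (j + 1) (by simp [StepBound.region]; omega)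
    simpa [stepDiff, StepBound.plus, StepBound.minus, StepBound.offset] using this
  · have := hf' .horizOddLower m (j + 1) (by simp [StepBound.region]; omega)
    simpa [stepDiff, StepBound.plus, StepBound.minus, StepBound.offset] using this
  · have := hf' .horizEvenUpper m (j + 1) (by simp [StepBound.region]; omega)
    simp [stepDiff, StepBound.plus, StepBound.minus, StepBound.offset] at this
    linarith
  · have := hf' .horizOddUpper (k - 1) 1 (by simp [StepBound.region])
    simp [stepDiff, StepBound.plus, StepBound.minus, StepBound.offset, hb.1] at this
    linarith
  · have := hf' .horizOddUpper m (j + 1) (by simp [StepBound.region]; omega)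
    simp [stepDiff, StepBound.plus, StepBound.minus, StepBound.offset] at this
    linarith
  · have := hf' .vertOddLower m j (by simp [StepBound.region]; omega)
    simpa [stepDiff, StepBound.plus, StepBound.minus, StepBound.offset] using this
  · have := hf' .vertEvenLower (m + 1) j (by simp [StepBound.region]; omega)
    simpa [stepDiff, StepBound.plus, StepBound.minus, StepBound.offset,
      show 2 * (m + 1) - 1 = 2 * m + 1 by omega] using this
  · have := hf' .vertEvenUpper (m + 1) j (by simp [StepBound.region]; omega)
    simp [stepDiff, StepBound.plus, StepBound.minus, StepBound.offset,
      show 2 * (m + 1) - 1 = 2 * m + 1 by omega] at this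
    linarith
  · have := hf' .vertOddUpper m j (by simp [StepBound.region]; omega)
    simp [stepDiff, StepBound.plus, StepBound.minus, StepBound.offset] at this
    linarith

lemma stepsIn_of_stepDiff {n k : ℕ} (hk : 3 ≤ k) (hn : n = 2 * k + 1) {h : ℕ → ℕ → ℝ}
    (hb : BoundaryValues k h) (hf : ∀ c ∈ facetIndex k, 0 ≤ stepDiff c h + c.1.offset) :
    StepsIn n k (Set.Icc 0 1) h := by
  have H := facetBounds_of_stepDiff hk hb hf
  refine ⟨fun i hi j hj => ?_, fun i hi j hj => ?_⟩ <;>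
  rw [Set.mem_Icc, sub_nonneg, sub_le_iff_le_add'] <;>
  obtain ⟨m, rfl | rfl⟩ := Nat.even_or_odd' i
  · have h1 := H.vertOdd_nonneg (m := m) (by omega) hj
    have h2 := H.vertOdd_le hk (m := m) (by omega) hj
    exact ⟨h1, h2⟩
  · have h1 := H.vertEven_nonneg hk (m := m) (by omega) hj
    have h2 := H.vertEven_le hk (m := m) (by omega) hj
    exact ⟨h1, h2⟩
  · have h1 := H.horizEven_nonneg hk (m := m) (by omega) hj
    have h2 := H.horizEven_le hk (m := m) (by omega) hj
    exact ⟨h1, h2⟩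
  · have h1 := H.horizOdd_nonneg hk (m := m) (by omega) hj
    have h2 := H.horizOdd_le hk (m := m) (by omega) hj
    exact ⟨h1, h2⟩

end Redundancy

section Facets

variable {n k : ℕ}

/-- The linear part of a step bound at the corner sums of a matrix. -/
def stepForm (n k : ℕ) (c : Σ _ : StepBound, ℕ × ℕ) : (Fin n → Fin k → ℝ) →ₗ[ℝ] ℝ :=
  cornerSum (c.1.plus c.2.1 c.2.2).1 (c.1.plus c.2.1 c.2.2).2 -
    cornerSum (c.1.minus c.2.1 c.2.2).1 (c.1.minus c.2.1 c.2.2).2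

lemma stepForm_apply (c : Σ _ : StepBound, ℕ × ℕ) (x : Fin n → Fin k → ℝ) :
    stepForm n k c x = stepDiff c fun i j => cornerSum i j x := rfl

/-- The matrices whose corner sums vanish on the boundary. -/
def boundarySubmodule (n k : ℕ) : Submodule ℝ (Fin n → Fin k → ℝ) where
  carrier := {x | BoundaryZero k fun i j => cornerSum i j x}
  zero_mem' := by simp [BoundaryZero]
  add_mem' {x y} hx hy := by
    refine ⟨by simp, fun i hi => ?_, fun j hj => ?_⟩
    · simpa using congrArg₂ (· + ·) (hx.2.1 i hi) (hy.2.1 i hi)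
    · obtain ⟨h1, h2, h3, h4⟩ := hx.2.2 j hj
      obtain ⟨h1', h2', h3', h4'⟩ := hy.2.2 j hj
      simp_all
  smul_mem' r x hx := by
    refine ⟨by simp, fun i hi => ?_, fun j hj => ?_⟩
    · have := hx.2.1 i hi
      simp_all
    · obtain ⟨h1, h2, h3, h4⟩ := hx.2.2 j hj
      simp_all

lemma sub_mem_boundarySubmodule_iff {o x : Fin n → Fin k → ℝ}
    (ho : BoundaryValues k fun i j => cornerSum i j o) :
    x - o ∈ boundarySubmodule n k ↔ BoundaryValues k fun i j => cornerSum i j x := by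
  change BoundaryZero k (fun i j => cornerSum i j (x - o)) ↔ _
  simp only [map_sub, BoundaryZero, BoundaryValues, sub_eq_zero, cornerSum_zero_right,
    implies_true, true_and]
  refine and_congr (forall₂_congr fun i hi => ?_) (forall₂_congr fun j hj => ?_)
  · have h := ho.2.1 i hi
    beta_reduce at h
    rw [h]
  · obtain ⟨h1, h2, h3, h4⟩ := ho.2.2 j hj
    beta_reduce at h1 h2 h3 h4
    rw [h1, h2, h3, h4]

lemma boundaryValues_cornerSum_blockOf (hn : n = 2 * k + 1) {h : ℕ → ℕ → ℝ}
    (hb : BoundaryValues k h) :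
    BoundaryValues k fun i j => cornerSum i j (blockOf h : Fin n → Fin k → ℝ) := by
  have hcs : ∀ i ≤ 2 * k + 1, ∀ j ≤ k,
      cornerSum i j (blockOf h : Fin n → Fin k → ℝ) = h i j :=
    fun i hi j hj => cornerSum_blockOf (fun j hj => (hb.2.2 j hj).1) hb.1 (by omega) hj
  refine ⟨by simp, fun i hi => ?_, fun j hj => ?_⟩
  · beta_reduce
    rw [hcs i hi k le_rfl, hb.2.1 i hi]
  · beta_reduce
    rw [hcs _ (by omega) j hj, hcs _ (by omega) j hj, hcs _ (by omega) j hj, hcs _ le_rfl j hj]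
    exact hb.2.2 j hj

lemma stepForm_blockOf (hk : 3 ≤ k) (hn : n = 2 * k + 1) {h : ℕ → ℕ → ℝ}
    (hb : BoundaryValues k h) {c : Σ _ : StepBound, ℕ × ℕ} (hc : c ∈ facetIndex k) :
    stepForm n k c (blockOf h) = stepDiff c h := by
  obtain ⟨c, m, j⟩ := c
  obtain ⟨hm, hmk, hj, hjk⟩ := mem_region_bounds hk
    (show (m, j) ∈ StepBound.region k c by simpa [facetIndex] using hc)
  rw [stepForm_apply, stepDiff, stepDiff]
  congr 1 <;>
  · refine cornerSum_blockOf (fun j hj => (hb.2.2 j hj).1) hb.1 ?_ ?_ <;> cases c <;>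
    simp only [StepBound.plus, StepBound.minus] <;> omega

lemma nonneg_of_stepsIn (hk : 3 ≤ k) (hn : n = 2 * k + 1) {h : ℕ → ℕ → ℝ}
    (hs : StepsIn n k (Set.Icc 0 1) h) {c : Σ _ : StepBound, ℕ × ℕ}
    (hc : c ∈ facetIndex k) : 0 ≤ stepDiff c h + c.1.offset := by
  obtain ⟨c, m, j⟩ := c
  obtain ⟨hm, hmk, hj, hjk⟩ := mem_region_bounds hk
    (show (m, j) ∈ StepBound.region k c by simpa [facetIndex] using hc)
  obtain ⟨j, rfl⟩ := Nat.exists_eq_add_of_le' hj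
  obtain ⟨m, rfl⟩ := Nat.exists_eq_add_of_le' hm
  have h1 := hs.2 (2 * (m + 1)) (by omega) j hjk
  have h2 := hs.2 (2 * (m + 1) + 1) (by omega) j hjk
  have h3 := hs.1 (2 * (m + 1)) (by omega) (j + 1) hjk
  have h4 := hs.1 (2 * m + 1) (by omega) (j + 1) hjk
  rw [Set.mem_Icc] at h1 h2 h3 h4
  cases c <;>
  simp only [stepDiff, StepBound.plus, StepBound.minus, StepBound.offset, Nat.add_sub_cancel,
    show 2 * (m + 1) = 2 * m + 1 + 1 by ring, Int.cast_zero, Int.cast_one] at h1 h2 h3 h4 ⊢ <;>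
  linarith

/-- An integral array, which divided by `2 * k` satisfies all step bounds strictly. -/
def interiorArray (k i j : ℕ) : ℤ :=
  2 * (i / 2 : ℕ) * j + if 2 ≤ i ∧ i < 2 * k ∧ i % 2 = 1 ∧ 1 ≤ j ∧ j < k then 1 else 0

lemma boundaryValues_interiorArray (hk : 3 ≤ k) :
    BoundaryValues k fun i j => (interiorArray k i j : ℝ) / (2 * k) := by
  have hk0 : (k : ℝ) ≠ 0 := by norm_cast; omega
  refine ⟨fun i => ?_, fun i hi => ?_, fun j hj => ⟨?_, ?_, ?_, ?_⟩⟩ <;>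
  beta_reduce <;> unfold interiorArray
  · simp
  · rw [if_neg (by omega)]
    generalize i / 2 = m
    push_cast
    field_simp
    ring
  · simp
  · simp
  · rw [if_neg (by omega), show 2 * k / 2 = k by omega]
    push_cast
    field_simp
    ring
  · rw [if_neg (by omega), show (2 * k + 1) / 2 = k by omega]
    push_cast
    field_simp
    ring

lemma interiorArray_even (k m j : ℕ) : interiorArray k (2 * m) j = 2 * m * j := by
  rw [interiorArray, if_neg (by omega), show 2 * m / 2 = m by omega, add_zero]

lemma interiorArray_odd_mem_Icc (k m j : ℕ) :
    interiorArray k (2 * m + 1) j ∈ Set.Icc (2 * m * j : ℤ) (2 * m * j + 1) := by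
  rw [interiorArray, show (2 * m + 1) / 2 = m by omega, Set.mem_Icc]
  split_ifs <;> simp

lemma interiorArray_odd {m j : ℕ} (hm : 1 ≤ m) (hmk : m < k) (hj : 1 ≤ j) (hjk : j < k) :
    interiorArray k (2 * m + 1) j = 2 * m * j + 1 := by
  rw [interiorArray, if_pos (by omega), show (2 * m + 1) / 2 = m by omega]

lemma stepDiff_interiorArray_pos (hk : 3 ≤ k) {c : Σ _ : StepBound, ℕ × ℕ}
    (hc : c ∈ facetIndex k) : 0 < stepDiff c (interiorArray k) + 2 * k * c.1.offset := by
  obtain ⟨c, m, j⟩ := c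
  replace hc : (m, j) ∈ StepBound.region k c := by simpa [facetIndex] using hc
  obtain ⟨hm, hmk, hj, hjk⟩ := mem_region_bounds hk hc
  obtain ⟨j, rfl⟩ := Nat.exists_eq_add_of_le' hj
  obtain ⟨m, rfl⟩ := Nat.exists_eq_add_of_le' hm
  have h1 := interiorArray_odd_mem_Icc k (m + 1) j
  have h2 := interiorArray_odd_mem_Icc k (m + 1) (j + 1)
  have h3 := interiorArray_odd_mem_Icc k m (j + 1)
  rw [Set.mem_Icc] at h1 h2 h3
  push_cast at h1 h2 h3
  cases c <;>
  simp only [StepBound.region, Finset.mem_insert, Prod.mk.injEq, Finset.mem_product,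
    Finset.mem_Icc] at hc <;>
  simp only [stepDiff, StepBound.plus, StepBound.minus, StepBound.offset, Nat.add_sub_cancel,
    show 2 * (m + 1) - 1 = 2 * m + 1 by omega, interiorArray_even]
  case vertOddLower =>
    rw [interiorArray_odd (by omega) (by omega) (by omega) (by omega)]
    simp
  case vertEvenUpper =>
    have : j + 2 ≤ k := by omega
    push_cast
    linarith
  all_goals
    push_cast
    linarith

/-- A point satisfying all facet inequalities strictly. -/
noncomputable def interiorPoint (n k : ℕ) : Fin n → Fin k → ℝ :=
  blockOf fun i j => (interiorArray k i j : ℝ) / (2 * k)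

lemma stepForm_interiorPoint_pos (hk : 3 ≤ k) (hn : n = 2 * k + 1)
    {c : Σ _ : StepBound, ℕ × ℕ} (hc : c ∈ facetIndex k) :
    0 < stepForm n k c (interiorPoint n k) + (c.1.offset : ℝ) := by
  rw [interiorPoint, stepForm_blockOf hk hn (boundaryValues_interiorArray hk) hc]
  have hk0 : (0 : ℝ) < 2 * k := by norm_cast; omega
  have h : (0 : ℝ) < (stepDiff c (interiorArray k) + 2 * k * c.1.offset : ℤ) :=
    Int.cast_pos.2 (stepDiff_interiorArray_pos hk hc)
  refine (div_pos h hk0).trans_eq ?_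
  simp only [stepDiff]
  push_cast
  field_simp

lemma IsWitness.exists_violating (hk : 3 ≤ k) (hn : n = 2 * k + 1)
    {e : Σ _ : StepBound, ℕ × ℕ} (he : e ∈ facetIndex k) {z d : ℕ → ℕ → ℤ}
    (h : IsWitness k e z d) :
    ∃ y : Fin n → Fin k → ℝ, (BoundaryValues k fun i j => cornerSum i j y) ∧
      stepForm n k e y + (e.1.offset : ℝ) < 0 ∧
      ∀ c ∈ facetIndex k, c ≠ e → 0 ≤ stepForm n k c y + (c.1.offset : ℝ) := by
  obtain ⟨ε, hε, hpos⟩ := exists_pos_forall_nonneg_add_mul (s := (facetIndex k).erase e)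
    (f := fun c => (stepDiff c z + c.1.offset : ℤ)) (g := fun c => (stepDiff c d : ℤ))
    fun c hc => by
      rw [Finset.mem_erase] at hc
      exact_mod_cast h.others c hc.2 hc.1
  have hb : BoundaryValues k fun i j => (z i j : ℝ) + ε * d i j := by
    refine ⟨fun i => ?_, fun i hi => ?_, fun j hj => ?_⟩
    · simp [h.boundary.1, h.boundaryZero.1]
    · beta_reduce
      rw [h.boundary.2.1 i hi, h.boundaryZero.2.1 i hi, Int.cast_natCast, Int.cast_zero, mul_zero,
        add_zero]
    · obtain ⟨h1, h2, h3, h4⟩ := h.boundary.2.2 j hj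
      obtain ⟨h1', h2', h3', h4'⟩ := h.boundaryZero.2.2 j hj
      simp [h1, h2, h3, h4, h1', h2', h3', h4']
  have hval : ∀ c ∈ facetIndex k, stepForm n k c (blockOf fun i j => (z i j : ℝ) + ε * d i j) +
      (c.1.offset : ℝ) = (stepDiff c z + c.1.offset : ℤ) + ε * (stepDiff c d : ℤ) := by
    intro c hc
    rw [stepForm_blockOf hk hn hb hc]
    simp only [stepDiff]
    push_cast
    ring
  refine ⟨blockOf fun i j => (z i j : ℝ) + ε * d i j, boundaryValues_cornerSum_blockOf hn hb, ?_,
    fun c hc hne => ?_⟩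
  · rw [hval e he, h.tight, Int.cast_zero, zero_add]
    exact mul_neg_of_pos_of_neg hε (Int.cast_lt_zero.2 h.violated)
  · rw [hval c hc]
    exact hpos c (Finset.mem_erase.2 ⟨hne, hc⟩)

lemma convexHull_symmetricBlocks (hk : 3 ≤ k) (hn : n = 2 * k + 1) (hkn : k ≤ n) :
    convexHull ℝ (symmetricBlocks n k hkn) =
      polyhedron (boundarySubmodule n k) (interiorPoint n k) (facetIndex k) (stepForm n k)
        (fun c => (c.1.offset : ℝ)) := by
  have ho := boundaryValues_cornerSum_blockOf (n := n) hn (boundaryValues_interiorArray hk)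
  refine (convexHull_min (fun x hx => ?_) (convex_polyhedron ..)).antisymm fun x hx => ?_
  · obtain ⟨hb, hs⟩ := steps_of_mem_symmetricBlocks hn hkn hx
    refine ⟨(sub_mem_boundarySubmodule_iff ho).2 hb, fun c hc => ?_⟩
    exact nonneg_of_stepsIn hk hn hs hc
  · have hb := (sub_mem_boundarySubmodule_iff ho).1 hx.1
    exact mem_convexHull_symmetricBlocks hn hkn hb (stepsIn_of_stepDiff hk hn hb hx.2)

lemma ncard_facets_symmetricBlocks (hk : 3 ≤ k) (hn : n = 2 * k + 1) (hkn : k ≤ n) :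
    {F | IsFacetOf (convexHull ℝ (symmetricBlocks n k hkn)) F}.ncard =
      2 * n ^ 2 + 49 - 19 * n := by
  have ho := boundaryValues_cornerSum_blockOf (n := n) hn (boundaryValues_interiorArray hk)
  rw [convexHull_symmetricBlocks hk hn hkn, hn, ← card_facetIndex hk, ← hn]
  refine ncard_facets_polyhedron (p := interiorPoint n k) (by simp)
    (fun c hc => stepForm_interiorPoint_pos hk hn hc) fun e he => ?_
  obtain ⟨z, d, h⟩ := exists_isWitness hk he
  obtain ⟨y, hb, hy⟩ := h.exists_violating hk hn he
  exact ⟨y, (sub_mem_boundarySubmodule_iff ho).2 hb, hy⟩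

end Facets

/-- For odd `n ≥ 7`, the core polytope of vertically symmetric ASMs (the convex
hull of the left `n × ⌊n/2⌋` blocks of VSASMs) has exactly `2n² - 19n + 49` facets. -/
theorem VSASM_core_polytope_facets (n : ℕ) (hn : 7 ≤ n) (hodd : Odd n) :
    {F : Set (Fin n → Fin (n / 2) → ℝ) |
        IsFacetOf
          (convexHull ℝ
            ((fun (X : Fin n → Fin n → ℝ) (i : Fin n) (j : Fin (n / 2)) =>
                X i (Fin.castLE (Nat.div_le_self n 2) j)) ''
              {X | IsASM n X ∧ ∀ i j, X i j = X i j.rev})) F}.ncard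
      = 2 * n ^ 2 + 49 - 19 * n :=
  ncard_facets_symmetricBlocks (by omega) (by obtain ⟨m, rfl⟩ := hodd; omega) _
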